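/- arXiv:2303.12814 — 14 statements merged into one kernel-verified Lean document; each statement's English description precedes it below -/
import Mathlib

section
/- Let f : ℝ → ℝ be a C¹ nowhere coexpanding function with no critical points, i.e. f'(x) ≠ 0 for all x ∈ ℝ. Then either the fixed point set Fix(f) = {x ∈ ℝ : f(x) = x} is a closed interval, or f has at most three fixed points (the set Fix(f) has cardinality at most 3). -/
open Set

/-- A C¹ function `f : ℝ → ℝ` is nowhere coexpanding if for every connected component of
`ℝ \ Crit f` and all distinct `x, y` in that component, `χ_f(x,y) ≤ 1`. -/
def NowhereCoexpanding (f : ℝ → ℝ) : Prop :=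
  ∀ x y : ℝ, x ≠ y →
    y ∈ connectedComponentIn {z : ℝ | deriv f z ≠ 0} x →
    deriv f x * deriv f y * ((x - y) / (f x - f y)) ^ 2 ≤ 1

lemma nce_aux1 (f : ℝ → ℝ) (hd : Differentiable ℝ f) (hpos : ∀ x, 0 < deriv f x)
    (h : ∀ x y, deriv f x * deriv f y * (x - y) ^ 2 ≤ (f x - f y) ^ 2)
    {x1 x2 z : ℝ} (h12 : x1 < x2) (h2 : x2 < z) :
    deriv f z * (f x2 - f x1) * ((z - x1) * (z - x2)) ≤
      (x2 - x1) * ((f z - f x1) * (f z - f x2)) := by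
  have hm : StrictMono f := strictMono_of_deriv_pos hpos
  have hder : ∀ x ∈ Icc x1 x2, HasDerivAt
      (fun x => (f z - f x)⁻¹ - (deriv f z * (z - x))⁻¹)
      (-(-deriv f x) / (f z - f x) ^ 2 - -(deriv f z * (-1)) / (deriv f z * (z - x)) ^ 2) x := by
    intro x hx
    have hxz : x < z := lt_of_le_of_lt hx.2 h2
    have e1 : HasDerivAt (fun x => f z - f x) (-deriv f x) x :=
      (hd x).hasDerivAt.const_sub (f z)
    have e2 : HasDerivAt (fun x => deriv f z * (z - x)) (deriv f z * (-1)) x :=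
      ((hasDerivAt_id x).const_sub z).const_mul _
    exact (e1.fun_inv (sub_pos.2 (hm hxz)).ne').sub
      (e2.fun_inv (mul_pos (hpos z) (sub_pos.2 hxz)).ne')
  have hanti : AntitoneOn (fun x => (f z - f x)⁻¹ - (deriv f z * (z - x))⁻¹) (Icc x1 x2) := by
    apply antitoneOn_of_deriv_nonpos (convex_Icc _ _)
    · exact fun x hx => (hder x hx).continuousAt.continuousWithinAt
    · exact fun x hx => (hder x (interior_subset hx)).differentiableAt.differentiableWithinAt
    · intro x hx
      have hx := interior_subset hx
      rw [(hder x hx).deriv]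
      have hxz : 0 < z - x := sub_pos.2 (lt_of_le_of_lt hx.2 h2)
      have hfz : 0 < f z - f x := sub_pos.2 (hm (lt_of_le_of_lt hx.2 h2))
      have hp := hpos z
      rw [sub_nonpos, div_le_div_iff₀ (by positivity) (by positivity)]
      nlinarith [mul_le_mul_of_nonneg_left (h z x) hp.le]
  have key := hanti (left_mem_Icc.2 h12.le) (right_mem_Icc.2 h12.le) h12.le
  have a1 : 0 < z - x1 := by linarith
  have a2 : 0 < z - x2 := by linarith
  have b1 : 0 < f z - f x1 := sub_pos.2 (hm (by linarith))
  have b2 : 0 < f z - f x2 := sub_pos.2 (hm (by linarith))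
  have hp := hpos z
  simp only at key
  have e1 : (f z - f x2)⁻¹ - (f z - f x1)⁻¹ = (f x2 - f x1) / ((f z - f x1) * (f z - f x2)) := by
    field_simp; ring
  have e2 : (deriv f z * (z - x2))⁻¹ - (deriv f z * (z - x1))⁻¹ =
      (x2 - x1) / (deriv f z * ((z - x1) * (z - x2))) := by
    field_simp; ring
  have k2 : (f x2 - f x1) / ((f z - f x1) * (f z - f x2)) ≤
      (x2 - x1) / (deriv f z * ((z - x1) * (z - x2))) := by
    rw [← e1, ← e2]; linarith
  rw [div_le_div_iff₀ (by positivity) (by positivity)] at k2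
  linarith

lemma nce_aux2 (f : ℝ → ℝ) (hd : Differentiable ℝ f) (hpos : ∀ x, 0 < deriv f x)
    (h : ∀ x y, deriv f x * deriv f y * (x - y) ^ 2 ≤ (f x - f y) ^ 2)
    {a b c d : ℝ} (hab : a < b) (hbc : b < c) (hcd : c < d)
    (fa : f a = a) (fb : f b = b) (fc : f c = c) (fd : f d = d) :
    ∀ z ∈ Icc c d, f z = z := by
  have hm : StrictMono f := strictMono_of_deriv_pos hpos
  have hsgn : ∀ x ∈ Icc c d, 0 < x - a ∧ 0 < x - b ∧ 0 < f x - a ∧ 0 < f x - b := by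
    intro x hx
    have h1 := hx.1
    have h2 : f a < f x := hm (by linarith)
    have h3 : f b < f x := hm (by linarith)
    refine ⟨?_, ?_, ?_, ?_⟩ <;> linarith
  have hder : ∀ x ∈ Icc c d, HasDerivAt
      (fun x => ((f x - b) * (x - a)) / ((f x - a) * (x - b)))
      (((deriv f x * (x - a) + (f x - b) * 1) * ((f x - a) * (x - b)) -
        ((f x - b) * (x - a)) * (deriv f x * (x - b) + (f x - a) * 1)) /
        ((f x - a) * (x - b)) ^ 2) x := by
    intro x hx
    obtain ⟨s1, s2, s3, s4⟩ := hsgn x hx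
    exact ((((hd x).hasDerivAt.sub_const b).mul ((hasDerivAt_id x).sub_const a))).fun_div
      ((((hd x).hasDerivAt.sub_const a).mul ((hasDerivAt_id x).sub_const b)))
      (mul_pos s3 s2).ne'
  have hanti : AntitoneOn (fun x => ((f x - b) * (x - a)) / ((f x - a) * (x - b))) (Icc c d) := by
    apply antitoneOn_of_deriv_nonpos (convex_Icc _ _)
    · exact fun x hx => (hder x hx).continuousAt.continuousWithinAt
    · exact fun x hx => (hder x (interior_subset hx)).differentiableAt.differentiableWithinAt
    · intro x hx
      have hx := interior_subset hx
      rw [(hder x hx).deriv]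
      apply div_nonpos_of_nonpos_of_nonneg _ (sq_nonneg _)
      have := nce_aux1 f hd hpos h hab (lt_of_lt_of_le hbc hx.1)
      rw [fa, fb] at this
      have h0 : 0 < b - a := by linarith
      linarith
  intro z hz
  have k1 := hanti (left_mem_Icc.2 hcd.le) hz hz.1
  have k2 := hanti hz (right_mem_Icc.2 hcd.le) hz.2
  simp only [fc, fd] at k1 k2
  obtain ⟨s1, s2, s3, s4⟩ := hsgn z hz
  have ec : (c - b) * (c - a) / ((c - a) * (c - b)) = 1 := by
    rw [mul_comm]; exact div_self (mul_pos (by linarith) (by linarith)).ne'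
  have ed : (d - b) * (d - a) / ((d - a) * (d - b)) = 1 := by
    rw [mul_comm]; exact div_self (mul_pos (by linarith) (by linarith)).ne'
  rw [ec] at k1
  rw [ed] at k2
  have k := le_antisymm k1 k2
  rw [div_eq_one_iff_eq (mul_pos s3 s2).ne'] at k
  have : (b - a) * (f z - z) = 0 := by linarith
  rcases mul_eq_zero.1 this with h | h <;> linarith

lemma nce_aux3 (f : ℝ → ℝ) (hd : Differentiable ℝ f) (hpos : ∀ x, 0 < deriv f x)
    (h : ∀ x y, deriv f x * deriv f y * (x - y) ^ 2 ≤ (f x - f y) ^ 2)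
    {a b c d : ℝ} (hab : a < b) (hbc : b < c) (hcd : c < d)
    (fa : f a = a) (fb : f b = b) (fc : f c = c) (fd : f d = d) :
    ∀ z ∈ Icc a d, f z = z := by
  have hR := nce_aux2 f hd hpos h hab hbc hcd fa fb fc fd
  have hg : ∀ x, HasDerivAt (fun x => - f (-x)) (deriv f (-x)) x := by
    intro x
    have := ((hd (-x)).hasDerivAt.comp x (hasDerivAt_neg x)).neg
    exact this.congr_deriv (by ring)
  have hg' : ∀ x, deriv (fun x => - f (-x)) x = deriv f (-x) := fun x => (hg x).deriv
  have hL := nce_aux2 (fun x => - f (-x)) (fun x => (hg x).differentiableAt)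
    (fun x => by rw [hg']; exact hpos _)
    (fun x y => by rw [hg', hg']; have := h (-x) (-y); nlinarith)
    (neg_lt_neg hcd) (neg_lt_neg hbc) (neg_lt_neg hab)
    (by simp [fd]) (by simp [fc]) (by simp [fb]) (by simp [fa])
  have hL' : ∀ z ∈ Icc a b, f z = z := by
    intro z hz
    have := hL (-z) ⟨neg_le_neg hz.2, neg_le_neg hz.1⟩
    simpa using this
  have hM := nce_aux2 f hd hpos h (a := a) (b := (a + b) / 2) (c := b) (d := c)
    (by linarith) (by linarith) hbc fa (hL' _ ⟨by linarith, by linarith⟩) fb fc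
  intro z hz
  rcases le_total z b with h1 | h1
  · exact hL' z ⟨hz.1, h1⟩
  rcases le_total z c with h2 | h2
  · exact hM z ⟨h1, h2⟩
  · exact hR z ⟨h2, hz.2⟩

theorem fix_of_nowhereCoexpanding (f : ℝ → ℝ)
    (hf : ContDiff ℝ 1 f) (hnc : NowhereCoexpanding f)
    (hreg : ∀ x : ℝ, deriv f x ≠ 0) :
    (IsClosed {x : ℝ | f x = x} ∧ ({x : ℝ | f x = x}).OrdConnected) ∨
      ({x : ℝ | f x = x}).encard ≤ 3 := by
  have hd : Differentiable ℝ f := hf.differentiable (by norm_num)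
  have hsign : (∀ x ∈ (univ : Set ℝ), deriv f x < 0) ∨ (∀ x ∈ (univ : Set ℝ), 0 < deriv f x) :=
    hasDerivWithinAt_forall_lt_or_forall_gt_of_forall_ne convex_univ
      (fun x _ => (hd x).hasDerivAt.hasDerivWithinAt) (fun x _ => hreg x)
  rcases hsign with hneg | hpos
  · right
    have hm : StrictAnti f := strictAnti_of_deriv_neg (fun x => hneg x (mem_univ x))
    refine le_trans (Set.encard_le_one_iff.2 ?_) (by norm_num)
    intro x y hx hy
    simp only [mem_setOf_eq] at hx hy
    rcases lt_trichotomy x y with h | h | h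
    · have := hm h; linarith
    · exact h
    · have := hm h; linarith
  replace hpos : ∀ x, 0 < deriv f x := fun x => hpos x (mem_univ x)
  have hm : StrictMono f := strictMono_of_deriv_pos hpos
  have h : ∀ x y, deriv f x * deriv f y * (x - y) ^ 2 ≤ (f x - f y) ^ 2 := by
    intro x y
    rcases eq_or_ne x y with rfl | hxy
    · simp
    have hu : {z : ℝ | deriv f z ≠ 0} = univ := eq_univ_of_forall hreg
    have := hnc x y hxy (by rw [hu, connectedComponentIn_univ]; simp)
    have hne : f x - f y ≠ 0 := sub_ne_zero.2 (hm.injective.ne hxy)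
    have hsq : 0 < (f x - f y) ^ 2 := by positivity
    rwa [div_pow, ← mul_div_assoc, div_le_one hsq] at this
  by_cases hcard : ({x : ℝ | f x = x}).encard ≤ 3
  · exact Or.inr hcard
  left
  refine ⟨isClosed_eq hd.continuous continuous_id, ?_⟩
  have h4 : (4 : ℕ∞) ≤ ({x : ℝ | f x = x}).encard := by
    have := Order.add_one_le_of_lt (not_le.1 hcard)
    norm_num at this
    exact this
  obtain ⟨t, hts, ht⟩ := Set.exists_subset_encard_eq h4
  have hfin : t.Finite := Set.finite_of_encard_eq_coe (k := 4) (by simpa using ht)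
  have hc : hfin.toFinset.card = 4 := by
    rw [hfin.encard_eq_coe_toFinset_card] at ht
    exact_mod_cast ht
  let e := hfin.toFinset.orderEmbOfFin hc
  have he : ∀ i, f (e i) = e i := fun i =>
    hts (hfin.mem_toFinset.1 (Finset.orderEmbOfFin_mem _ hc i))
  have h01 : e 0 < e 1 := e.strictMono (by decide)
  have h12 : e 1 < e 2 := e.strictMono (by decide)
  have h23 : e 2 < e 3 := e.strictMono (by decide)
  refine ⟨fun x hx y hy z hz => ?_⟩
  simp only [mem_setOf_eq] at hx hy
  have hA : f (min x (e 0)) = min x (e 0) := by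
    rcases min_choice x (e 0) with h | h <;> rw [h]
    exacts [hx, he 0]
  have hD : f (max y (e 3)) = max y (e 3) := by
    rcases max_choice y (e 3) with h | h <;> rw [h]
    exacts [hy, he 3]
  exact nce_aux3 f hd hpos h (lt_of_le_of_lt (min_le_right x (e 0)) h01) h12
    (lt_of_lt_of_le h23 (le_max_right y (e 3))) hA (he 1) (he 2) hD z
    ⟨(min_le_left _ _).trans hz.1, hz.2.trans (le_max_left _ _)⟩
end

section
/- Let f : ℝ → ℝ be a C³ function. Then f is nowhere coexpanding if and only if its Schwarzian derivative satisfies S_f(x) ≤ 0 for every x ∈ ℝ with f'(x) ≠ 0. -/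
open Set

/-- The Schwarzian derivative `S_f(x) = f'''(x)/f'(x) - (3/2)(f''(x)/f'(x))²`. -/
noncomputable def schwarzian (f : ℝ → ℝ) (x : ℝ) : ℝ :=
  iteratedDeriv 3 f x / deriv f x - (3 / 2) * (iteratedDeriv 2 f x / deriv f x) ^ 2

section helpers

variable {f g g1 g2 : ℝ → ℝ}

lemma aux_h1 (hg : ∀ x, HasDerivAt g (g1 x) x) {x : ℝ} (hx : 0 < g x) :
    HasDerivAt (fun t => (Real.sqrt (g t))⁻¹) (-(g1 x) / (2 * Real.sqrt (g x) ^ 3)) x := by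
  have hs : 0 < Real.sqrt (g x) := Real.sqrt_pos.2 hx
  refine (((hg x).sqrt hx.ne').fun_inv hs.ne').congr_deriv ?_
  field_simp

lemma aux_h2 (hg : ∀ x, HasDerivAt g (g1 x) x) (hg1 : ∀ x, HasDerivAt g1 (g2 x) x)
    {x : ℝ} (hx : 0 < g x) :
    HasDerivAt (fun t => -(g1 t) / (2 * Real.sqrt (g t) ^ 3))
      (-(g2 x / g x - 3 / 2 * (g1 x / g x) ^ 2) / (2 * Real.sqrt (g x))) x := by
  have hs : 0 < Real.sqrt (g x) := Real.sqrt_pos.2 hx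
  have hsq : g x = Real.sqrt (g x) ^ 2 := (Real.sq_sqrt hx.le).symm
  have hd := (((hg x).sqrt hx.ne').fun_pow 3).const_mul 2
  have := (hg1 x).fun_neg.fun_div hd (by positivity)
  refine this.congr_deriv ?_
  simp only [Nat.cast_ofNat]
  generalize Real.sqrt (g x) = s at *
  rw [hsq]
  field_simp
  ring

lemma aux_G {p q a b t : ℝ} (hab : a < b) (hp : 0 < p) (hq : 0 < q)
    (ht : t ∈ Icc a b) :
    0 < p * (b - t) + q * (t - a) ∧
    HasDerivAt (fun t => (t - a) * (b - a) / (p * (p * (b - t) + q * (t - a))))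
      (((p * (b - t) + q * (t - a)) / (b - a))⁻¹ ^ 2) t := by
  obtain ⟨h1, h2⟩ := ht
  have hL : 0 < p * (b - t) + q * (t - a) := by
    rcases h1.eq_or_lt with rfl | h1
    · nlinarith
    · nlinarith [mul_pos hq (sub_pos.2 h1), mul_nonneg hp.le (sub_nonneg.2 h2)]
  refine ⟨hL, ?_⟩
  have i := hasDerivAt_id' t
  have := ((i.sub_const a).mul_const (b - a)).fun_div
    ((((i.const_sub b).const_mul p).fun_add ((i.sub_const a).const_mul q)).const_mul p)
    (by positivity)
  have hba : b - a ≠ 0 := (sub_pos.2 hab).ne'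
  refine this.congr_deriv ?_
  field_simp
  ring

lemma lem_convex (hf : ∀ x, HasDerivAt f (g x) x) (hg : ∀ x, HasDerivAt g (g1 x) x)
    (hg1 : ∀ x, HasDerivAt g1 (g2 x) x) {a b : ℝ} (hab : a < b)
    (hpos : ∀ x ∈ Icc a b, 0 < g x)
    (hS : ∀ x ∈ Icc a b, g2 x / g x - 3 / 2 * (g1 x / g x) ^ 2 ≤ 0) :
    Real.sqrt (g a) * Real.sqrt (g b) * (b - a) ≤ f b - f a := by
  have hba : 0 < b - a := sub_pos.2 hab
  have ha := left_mem_Icc.2 hab.le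
  have hb := right_mem_Icc.2 hab.le
  have sp : ∀ x ∈ Icc a b, 0 < Real.sqrt (g x) := fun x hx => Real.sqrt_pos.2 (hpos x hx)
  have hconv : ConvexOn ℝ (Icc a b) (fun t => (Real.sqrt (g t))⁻¹) := by
    refine convexOn_of_hasDerivWithinAt2_nonneg (convex_Icc a b)
      (fun x hx => (aux_h1 hg (hpos x hx)).continuousAt.continuousWithinAt)
      (fun x hx => (aux_h1 hg (hpos x (interior_subset hx))).hasDerivWithinAt)
      (fun x hx => (aux_h2 hg hg1 (hpos x (interior_subset hx))).hasDerivWithinAt) ?_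
    intro x hx
    have := hS x (interior_subset hx)
    have := sp x (interior_subset hx)
    apply div_nonneg <;> linarith
  set p := (Real.sqrt (g a))⁻¹ with hp
  set q := (Real.sqrt (g b))⁻¹ with hq
  have pp : 0 < p := inv_pos.2 (sp a ha)
  have qp : 0 < q := inv_pos.2 (sp b hb)
  have hd : ∀ t ∈ Icc a b, HasDerivAt
      (fun t => f t - (t - a) * (b - a) / (p * (p * (b - t) + q * (t - a))))
      (g t - ((p * (b - t) + q * (t - a)) / (b - a))⁻¹ ^ 2) t := fun t ht =>
    (hf t).sub (aux_G hab pp qp ht).2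
  have hm : MonotoneOn (fun t => f t - (t - a) * (b - a) / (p * (p * (b - t) + q * (t - a))))
      (Icc a b) := by
    refine monotoneOn_of_hasDerivWithinAt_nonneg (convex_Icc a b)
      (fun x hx => (hd x hx).continuousAt.continuousWithinAt)
      (fun x hx => (hd x (interior_subset hx)).hasDerivWithinAt) ?_
    intro t ht
    have ht := interior_subset ht
    have hL := (aux_G hab pp qp ht).1
    have hc := hconv.2 ha hb
      (div_nonneg (sub_nonneg.2 ht.2) hba.le) (div_nonneg (sub_nonneg.2 ht.1) hba.le)
      (show (b - t) / (b - a) + (t - a) / (b - a) = 1 by field_simp; ring)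
    have e : (b - t) / (b - a) * a + (t - a) / (b - a) * b = t := by field_simp; ring
    simp only [smul_eq_mul, e] at hc
    have e2 : (b - t) / (b - a) * p + (t - a) / (b - a) * q
      = (p * (b - t) + q * (t - a)) / (b - a) := by field_simp
    rw [← hp, ← hq, e2] at hc
    have h3 := inv_anti₀ (inv_pos.2 (sp t ht)) hc
    rw [inv_inv] at h3
    have h4 := pow_le_pow_left₀ (inv_pos.2 (div_pos hL hba)).le h3 2
    rw [Real.sq_sqrt (hpos t ht).le] at h4
    linarith
  have := hm ha hb hab.le
  simp only [sub_self, zero_mul, zero_div, mul_zero, zero_add] at this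
  have e3 : (b - a) * (b - a) / (p * (q * (b - a))) = √(g a) * √(g b) * (b - a) := by
    have := sp a ha
    have := sp b hb
    rw [hp, hq]
    field_simp
  rw [e3] at this
  linarith

lemma lem_concave (hf : ∀ x, HasDerivAt f (g x) x) (hg : ∀ x, HasDerivAt g (g1 x) x)
    (hg1 : ∀ x, HasDerivAt g1 (g2 x) x) {a b : ℝ} (hab : a < b)
    (hpos : ∀ x ∈ Icc a b, 0 < g x)
    (hS : ∀ x ∈ Icc a b, 0 < g2 x / g x - 3 / 2 * (g1 x / g x) ^ 2) :
    0 < f b - f a ∧ f b - f a < Real.sqrt (g a) * Real.sqrt (g b) * (b - a) := by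
  have hba : 0 < b - a := sub_pos.2 hab
  have ha := left_mem_Icc.2 hab.le
  have hb := right_mem_Icc.2 hab.le
  have sp : ∀ x ∈ Icc a b, 0 < Real.sqrt (g x) := fun x hx => Real.sqrt_pos.2 (hpos x hx)
  have hconv : StrictConcaveOn ℝ (Icc a b) (fun t => (Real.sqrt (g t))⁻¹) := by
    refine StrictAntiOn.strictConcaveOn_of_deriv (convex_Icc a b)
      (fun x hx => (aux_h1 hg (hpos x hx)).continuousAt.continuousWithinAt) ?_
    have : StrictAntiOn (fun t => -(g1 t) / (2 * Real.sqrt (g t) ^ 3)) (Icc a b) := by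
      refine strictAntiOn_of_hasDerivWithinAt_neg (convex_Icc a b)
        (fun x hx => (aux_h2 hg hg1 (hpos x hx)).continuousAt.continuousWithinAt)
        (fun x hx => (aux_h2 hg hg1 (hpos x (interior_subset hx))).hasDerivWithinAt) ?_
      intro x hx
      have := hS x (interior_subset hx)
      have := sp x (interior_subset hx)
      apply div_neg_of_neg_of_pos <;> linarith
    intro x hx y hy hxy
    rw [(aux_h1 hg (hpos x (interior_subset hx))).deriv,
      (aux_h1 hg (hpos y (interior_subset hy))).deriv]
    exact this (interior_subset hx) (interior_subset hy) hxy
  refine ⟨?_, ?_⟩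
  · have : StrictMonoOn f (Icc a b) := 
      strictMonoOn_of_hasDerivWithinAt_pos (convex_Icc a b)
        (fun x hx => (hf x).continuousAt.continuousWithinAt)
        (fun x hx => (hf x).hasDerivWithinAt) (fun x hx => hpos x (interior_subset hx))
    exact sub_pos.2 (this ha hb hab)
  set p := (Real.sqrt (g a))⁻¹ with hp
  set q := (Real.sqrt (g b))⁻¹ with hq
  have pp : 0 < p := inv_pos.2 (sp a ha)
  have qp : 0 < q := inv_pos.2 (sp b hb)
  have hd : ∀ t ∈ Icc a b, HasDerivAt
      (fun t => f t - (t - a) * (b - a) / (p * (p * (b - t) + q * (t - a))))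
      (g t - ((p * (b - t) + q * (t - a)) / (b - a))⁻¹ ^ 2) t := fun t ht =>
    (hf t).sub (aux_G hab pp qp ht).2
  have hm : StrictAntiOn (fun t => f t - (t - a) * (b - a) / (p * (p * (b - t) + q * (t - a))))
      (Icc a b) := by
    refine strictAntiOn_of_hasDerivWithinAt_neg (convex_Icc a b)
      (fun x hx => (hd x hx).continuousAt.continuousWithinAt)
      (fun x hx => (hd x (interior_subset hx)).hasDerivWithinAt) ?_
    intro t ht0
    have ht := interior_subset ht0
    rw [interior_Icc] at ht0
    have hL := (aux_G hab pp qp ht).1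
    have hc := hconv.2 ha hb hab.ne
      (div_pos (sub_pos.2 ht0.2) hba) (div_pos (sub_pos.2 ht0.1) hba)
      (show (b - t) / (b - a) + (t - a) / (b - a) = 1 by field_simp; ring)
    have e : (b - t) / (b - a) * a + (t - a) / (b - a) * b = t := by field_simp; ring
    simp only [smul_eq_mul, e] at hc
    have e2 : (b - t) / (b - a) * p + (t - a) / (b - a) * q
      = (p * (b - t) + q * (t - a)) / (b - a) := by field_simp
    rw [← hp, ← hq, e2] at hc
    have h3 := inv_strictAnti₀ (div_pos hL hba) hc
    rw [inv_inv] at h3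
    have h4 := pow_lt_pow_left₀ h3 (sp t ht).le two_ne_zero
    rw [Real.sq_sqrt (hpos t ht).le] at h4
    linarith
  have := hm ha hb hab
  simp only [sub_self, zero_mul, zero_div, mul_zero, zero_add] at this
  have e3 : (b - a) * (b - a) / (p * (q * (b - a))) = √(g a) * √(g b) * (b - a) := by
    have := sp a ha
    have := sp b hb
    rw [hp, hq]
    field_simp
  rw [e3] at this
  linarith

lemma chi_convex (hf : ∀ x, HasDerivAt f (g x) x) (hg : ∀ x, HasDerivAt g (g1 x) x)
    (hg1 : ∀ x, HasDerivAt g1 (g2 x) x) {a b : ℝ} (hab : a < b)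
    (hpos : ∀ x ∈ Icc a b, 0 < g x)
    (hS : ∀ x ∈ Icc a b, g2 x / g x - 3 / 2 * (g1 x / g x) ^ 2 ≤ 0) :
    g a * g b * ((a - b) / (f a - f b)) ^ 2 ≤ 1 := by
  have h := lem_convex hf hg hg1 hab hpos hS
  have ha := hpos a (left_mem_Icc.2 hab.le)
  have hb := hpos b (right_mem_Icc.2 hab.le)
  have hba : 0 < b - a := sub_pos.2 hab
  have h0 : 0 < √(g a) * √(g b) * (b - a) := by positivity
  have h2 := pow_le_pow_left₀ h0.le h 2
  rw [mul_pow, mul_pow, Real.sq_sqrt ha.le, Real.sq_sqrt hb.le] at h2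
  rw [div_pow, ← mul_div_assoc, div_le_one (by nlinarith)]
  nlinarith

lemma chi_concave (hf : ∀ x, HasDerivAt f (g x) x) (hg : ∀ x, HasDerivAt g (g1 x) x)
    (hg1 : ∀ x, HasDerivAt g1 (g2 x) x) {a b : ℝ} (hab : a < b)
    (hpos : ∀ x ∈ Icc a b, 0 < g x)
    (hS : ∀ x ∈ Icc a b, 0 < g2 x / g x - 3 / 2 * (g1 x / g x) ^ 2) :
    1 < g a * g b * ((a - b) / (f a - f b)) ^ 2 := by
  obtain ⟨h0, h⟩ := lem_concave hf hg hg1 hab hpos hS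
  have ha := hpos a (left_mem_Icc.2 hab.le)
  have hb := hpos b (right_mem_Icc.2 hab.le)
  have h2 := pow_lt_pow_left₀ h h0.le two_ne_zero
  rw [mul_pow, mul_pow, Real.sq_sqrt ha.le, Real.sq_sqrt hb.le] at h2
  rw [div_pow, ← mul_div_assoc, one_lt_div (by nlinarith)]
  nlinarith

lemma sign_cases (hg : Continuous g) {a b : ℝ} (h : ∀ x ∈ Icc a b, g x ≠ 0) :
    (∀ x ∈ Icc a b, 0 < g x) ∨ (∀ x ∈ Icc a b, 0 < -g x) := by
  by_contra! hc
  obtain ⟨⟨x, hx, hx0⟩, ⟨y, hy, hy0⟩⟩ := hc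
  obtain ⟨z, hz, hz0⟩ := isPreconnected_Icc.intermediate_value hx hy hg.continuousOn
    (show (0 : ℝ) ∈ Icc (g x) (g y) from ⟨hx0, by linarith⟩)
  exact h z hz hz0

lemma chi_convex' (hf : ∀ x, HasDerivAt f (g x) x) (hg : ∀ x, HasDerivAt g (g1 x) x)
    (hg1 : ∀ x, HasDerivAt g1 (g2 x) x) {a b : ℝ} (hab : a < b)
    (hne : ∀ x ∈ Icc a b, g x ≠ 0)
    (hS : ∀ x ∈ Icc a b, g2 x / g x - 3 / 2 * (g1 x / g x) ^ 2 ≤ 0) :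
    g a * g b * ((a - b) / (f a - f b)) ^ 2 ≤ 1 := by
  rcases sign_cases (continuous_iff_continuousAt.2 fun x => (hg x).continuousAt) hne with h | h
  · exact chi_convex hf hg hg1 hab h hS
  · have := chi_convex (fun x => (hf x).fun_neg) (fun x => (hg x).fun_neg)
      (fun x => (hg1 x).fun_neg) hab h (by simpa only [neg_div_neg_eq] using hS)
    rw [neg_mul_neg, show -f a - -f b = -(f a - f b) by ring, div_neg, neg_sq] at this
    exact this

lemma chi_concave' (hf : ∀ x, HasDerivAt f (g x) x) (hg : ∀ x, HasDerivAt g (g1 x) x)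
    (hg1 : ∀ x, HasDerivAt g1 (g2 x) x) {a b : ℝ} (hab : a < b)
    (hne : ∀ x ∈ Icc a b, g x ≠ 0)
    (hS : ∀ x ∈ Icc a b, 0 < g2 x / g x - 3 / 2 * (g1 x / g x) ^ 2) :
    1 < g a * g b * ((a - b) / (f a - f b)) ^ 2 := by
  rcases sign_cases (continuous_iff_continuousAt.2 fun x => (hg x).continuousAt) hne with h | h
  · exact chi_concave hf hg hg1 hab h hS
  · have := chi_concave (fun x => (hf x).fun_neg) (fun x => (hg x).fun_neg)
      (fun x => (hg1 x).fun_neg) hab h (by simpa only [neg_div_neg_eq] using hS)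
    rw [neg_mul_neg, show -f a - -f b = -(f a - f b) by ring, div_neg, neg_sq] at this
    exact this

end helpers

theorem nowhereCoexpanding_iff_schwarzian_nonpos (f : ℝ → ℝ)
    (hf : ContDiff ℝ 3 f) :
    NowhereCoexpanding f ↔ ∀ x : ℝ, deriv f x ≠ 0 → schwarzian f x ≤ 0 := by
  have d0 : ∀ x, HasDerivAt f (deriv f x) x := fun x =>
    (hf.differentiable (by norm_num) x).hasDerivAt
  have d1 : ∀ x, HasDerivAt (deriv f) (iteratedDeriv 2 f x) x := fun x => by
    have := (hf.differentiable_iteratedDeriv 1 (by norm_num) x).hasDerivAt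
    rw [← iteratedDeriv_succ, iteratedDeriv_one] at this
    exact this
  have d2 : ∀ x, HasDerivAt (iteratedDeriv 2 f) (iteratedDeriv 3 f x) x := fun x => by
    have := (hf.differentiable_iteratedDeriv 2 (by norm_num) x).hasDerivAt
    rw [← iteratedDeriv_succ] at this
    exact this
  have c3 : Continuous (iteratedDeriv 3 f) := hf.continuous_iteratedDeriv 3 (by norm_num)
  constructor
  · intro H x hx
    by_contra! hS
    have hc : ContinuousAt (schwarzian f) x := by
      unfold schwarzian
      have k1 := (d1 x).continuousAt
      have k2 := (d2 x).continuousAt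
      exact (c3.continuousAt.div k1 hx).sub (((k2.div k1 hx).pow 2).const_mul _)
    have hev := (hc.eventually (lt_mem_nhds hS)).and ((d1 x).continuousAt.eventually_ne hx)
    obtain ⟨ε, he, hb⟩ := Metric.eventually_nhds_iff.1 hev
    have hI : ∀ t ∈ Icc x (x + ε / 2), 0 < schwarzian f t ∧ deriv f t ≠ 0 := by
      intro t ht
      apply hb
      rw [Real.dist_eq, abs_lt]
      constructor <;> linarith [ht.1, ht.2]
    have hlt : x < x + ε / 2 := by linarith
    have h1 := chi_concave' d0 d1 d2 hlt (fun t ht => (hI t ht).2) (fun t ht => (hI t ht).1)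
    have h2 := H x (x + ε / 2) hlt.ne
      (isPreconnected_Icc.subset_connectedComponentIn (left_mem_Icc.2 hlt.le)
        (fun t ht => (hI t ht).2) (right_mem_Icc.2 hlt.le))
    linarith
  · intro H x y hxy hy
    have hx : x ∈ {z : ℝ | deriv f z ≠ 0} := by
      by_contra hx
      rw [connectedComponentIn_eq_empty hx] at hy
      exact hy
    have hx' := mem_connectedComponentIn hx
    have hoc := (isPreconnected_connectedComponentIn (x := x)
      (F := {z : ℝ | deriv f z ≠ 0})).ordConnected
    have hsub := connectedComponentIn_subset {z : ℝ | deriv f z ≠ 0} x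
    rcases hxy.lt_or_gt with h | h
    · have hn : ∀ t ∈ Icc x y, deriv f t ≠ 0 := fun t ht => hsub (hoc.out hx' hy ht)
      exact chi_convex' d0 d1 d2 h hn (fun t ht => H t (hn t ht))
    · have hn : ∀ t ∈ Icc y x, deriv f t ≠ 0 := fun t ht => hsub (hoc.out hy hx' ht)
      have := chi_convex' d0 d1 d2 h hn (fun t ht => H t (hn t ht))
      rw [mul_comm (deriv f x), ← neg_sub y x, ← neg_sub (f y), neg_div_neg_eq]
      exact this
end

section
/- Let f : ℝ → ℝ be a C¹ nowhere coexpanding function and let p be a topologically attracting periodic point of f of period n, i.e. f^n(p) = p and the basin Basin(p) = {x ∈ ℝ : lim_{k→∞} f^{nk}(x) = p} is a neighbourhood of p. Then either the immediate basin of p (the connected component of Basin(p) containing p) is an unbounded set, or there exists a critical point c of f (f'(c) = 0) whose orbit is attracted to the orbit of p, i.e. there exists 0 ≤ m < n with lim_{k→∞} f^{nk}(c) = f^m(p). -/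
open Set Filter

/-- The basin of a periodic point `p` of period `n`. -/
def Basin (f : ℝ → ℝ) (n : ℕ) (p : ℝ) : Set ℝ :=
  {x : ℝ | Tendsto (fun k : ℕ => f^[n * k] x) atTop (nhds p)}

lemma step_aux (f : ℝ → ℝ) (hf : ContDiff ℝ 1 f) (hnc : NowhereCoexpanding f) (T : Set ℝ)
    (hT : IsPreconnected T) (hTS : ∀ z ∈ T, deriv f z ≠ 0) (X Y : ℝ) (hX : X ∈ T) (hY : Y ∈ T) :
    0 < deriv f X * deriv f Y ∧
      deriv f X * deriv f Y * (X - Y) ^ 2 ≤ (f X - f Y) ^ 2 := by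
  have hc : Continuous (deriv f) := hf.continuous_deriv le_rfl
  have hd : Differentiable ℝ f := hf.differentiable (by norm_num)
  have hoc : T.OrdConnected := hT.ordConnected
  constructor
  · by_contra h
    have himg : (deriv f '' T).OrdConnected := (hT.image _ hc.continuousOn).ordConnected
    have h0 : (0 : ℝ) ∈ deriv f '' T := by
      have hXn := hTS X hX
      have hYn := hTS Y hY
      rcases lt_or_gt_of_ne hXn with h1 | h1
      · have h2 : 0 ≤ deriv f Y := by
          by_contra h2
          exact h (mul_pos_of_neg_of_neg h1 (not_le.mp h2))
        exact himg.out ⟨X, hX, rfl⟩ ⟨Y, hY, rfl⟩ ⟨h1.le, h2⟩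
      · have h2 : deriv f Y ≤ 0 := by
          by_contra h2
          exact h (mul_pos h1 (not_le.mp h2))
        exact himg.out ⟨Y, hY, rfl⟩ ⟨X, hX, rfl⟩ ⟨h2, h1.le⟩
    obtain ⟨z, hz, hz0⟩ := h0
    exact hTS z hz hz0
  · by_cases hXY : X = Y
    · subst hXY; simp
    have hne : f X ≠ f Y := by
      intro he
      rcases lt_or_gt_of_ne hXY with h1 | h1
      · obtain ⟨c, hc1, hc2⟩ := exists_deriv_eq_zero h1 hf.continuous.continuousOn he
        exact hTS c (hoc.out hX hY ⟨hc1.1.le, hc1.2.le⟩) hc2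
      · obtain ⟨c, hc1, hc2⟩ := exists_deriv_eq_zero h1 hf.continuous.continuousOn he.symm
        exact hTS c (hoc.out hY hX ⟨hc1.1.le, hc1.2.le⟩) hc2
    have := hnc X Y hXY (hT.subset_connectedComponentIn hX hTS hY)
    have hp : 0 < (f X - f Y) ^ 2 := by
      have := sub_ne_zero.mpr hne
      positivity
    rw [div_pow, ← mul_div_assoc, div_le_one hp] at this
    exact this

lemma iter_aux (f : ℝ → ℝ) (hf : ContDiff ℝ 1 f) (hnc : NowhereCoexpanding f) (B : Set ℝ)
    (hB : IsPreconnected B) (hBS : ∀ j : ℕ, ∀ z ∈ B, deriv f (f^[j] z) ≠ 0) (j : ℕ) :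
    ∀ x ∈ B, ∀ y ∈ B, 0 < deriv f^[j] x * deriv f^[j] y ∧
      deriv f^[j] x * deriv f^[j] y * (x - y) ^ 2 ≤ (f^[j] x - f^[j] y) ^ 2 := by
  have hd : Differentiable ℝ f := hf.differentiable (by norm_num)
  induction j with
  | zero => intro x _ y _; simp
  | succ j ih =>
    intro x hx y hy
    have key : ∀ x, deriv f^[j+1] x = deriv f (f^[j] x) * deriv f^[j] x := by
      intro x
      rw [Function.iterate_succ']
      exact deriv_comp x (hd _) ((hd.iterate j) x)
    obtain ⟨i1, i2⟩ := ih x hx y hy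
    obtain ⟨s1, s2⟩ := step_aux f hf hnc (f^[j] '' B)
      (hB.image _ (hf.continuous.iterate j).continuousOn)
      (by rintro _ ⟨z, hz, rfl⟩; exact hBS j z hz) (f^[j] x) (f^[j] y) ⟨x, hx, rfl⟩ ⟨y, hy, rfl⟩
    rw [key, key, Function.iterate_succ_apply', Function.iterate_succ_apply']
    constructor
    · have := mul_pos s1 i1
      linarith
    · have := mul_le_mul_of_nonneg_left i2 s1.le
      linarith

lemma real_aux (G : ℝ → ℝ) (hG : ContDiff ℝ 1 G) (a p b : ℝ) (hap : a < p) (hpb : p < b)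
    (ha : G a = a) (hp : G p = p) (hb : G b = b) (hlow : ∀ x ∈ Ioo a p, x ≤ G x)
    (hmono : StrictMonoOn G (Icc a b))
    (hineq : ∀ x ∈ Ioo a b, ∀ y ∈ Ioo a b,
      deriv G x * deriv G y * (x - y) ^ 2 ≤ (G x - G y) ^ 2)
    (hpos : ∀ x ∈ Ioo a b, 0 < deriv G x) :
    ∃ q ∈ Ioo p b, G q = q := by
  have hc : Continuous (deriv G) := hG.continuous_deriv le_rfl
  have hd : Differentiable ℝ G := hG.differentiable (by norm_num)
  have hda : 1 ≤ deriv G a := by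
    have h1 : Tendsto (slope G a) (nhdsWithin a (Ioi a)) (nhds (deriv G a)) :=
      (hasDerivAt_iff_tendsto_slope.mp (hd a).hasDerivAt).mono_left
        (nhdsWithin_mono _ (fun x hx => ne_of_gt hx))
    refine ge_of_tendsto h1 ?_
    filter_upwards [Ioo_mem_nhdsGT hap] with x hx
    rw [slope_def_field, ha, le_div_iff₀ (by linarith [hx.1])]
    linarith [hlow x hx]
  have hia : ∀ y ∈ Ioo a b, deriv G a * deriv G y * (a - y) ^ 2 ≤ (G a - G y) ^ 2 := by
    intro y hy
    have h1 : Tendsto (fun x => deriv G x * deriv G y * (x - y) ^ 2) (nhdsWithin a (Ioi a))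
        (nhds (deriv G a * deriv G y * (a - y) ^ 2)) :=
      (Continuous.tendsto (by fun_prop) a).mono_left nhdsWithin_le_nhds
    have hGc := hG.continuous
    have h2 : Tendsto (fun x => (G x - G y) ^ 2) (nhdsWithin a (Ioi a))
        (nhds ((G a - G y) ^ 2)) :=
      (Continuous.tendsto (by fun_prop) a).mono_left nhdsWithin_le_nhds
    refine le_of_tendsto_of_tendsto h1 h2 ?_
    filter_upwards [Ioo_mem_nhdsGT (hap.trans hpb)] with x hx
    exact hineq x hx y hy
  have hGa : ∀ y ∈ Icc p b, 0 < G y - a := by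
    intro y hy
    have := hmono ⟨le_rfl, (hap.trans hpb).le⟩ ⟨hap.le.trans hy.1, hy.2⟩ (hap.trans_le hy.1)
    linarith
  have hanti : AntitoneOn (fun y => (y - a)⁻¹ - (G y - a)⁻¹) (Icc p b) := by
    have hder : ∀ y ∈ Icc p b, HasDerivAt (fun y => (y - a)⁻¹ - (G y - a)⁻¹)
        (-1 / (y - a) ^ 2 - -(deriv G y) / (G y - a) ^ 2) y := by
      intro y hy
      have e1 : HasDerivAt (fun y => y - a) 1 y := (hasDerivAt_id y).sub_const a
      have e2 : HasDerivAt (fun y => G y - a) (deriv G y) y := (hd y).hasDerivAt.sub_const a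
      exact (e1.fun_inv (by linarith [hy.1])).sub (e2.fun_inv (hGa y hy).ne')
    apply antitoneOn_of_deriv_nonpos (convex_Icc p b)
    · exact fun y hy => (hder y hy).continuousAt.continuousWithinAt
    · intro y hy
      rw [interior_Icc] at hy
      exact (hder y ⟨hy.1.le, hy.2.le⟩).differentiableAt.differentiableWithinAt
    · intro y hy
      rw [interior_Icc] at hy
      rw [(hder y ⟨hy.1.le, hy.2.le⟩).deriv]
      have hy' : y ∈ Ioo a b := ⟨hap.trans hy.1, hy.2⟩
      have h1 := hia y hy'
      have h2 := hpos y hy'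
      have h3 := hGa y ⟨hy.1.le, hy.2.le⟩
      have h4 : 0 < y - a := by linarith [hy'.1]
      rw [ha] at h1
      have h5 : deriv G y * (y - a) ^ 2 ≤ 1 * (G y - a) ^ 2 := by
        have : 0 ≤ (deriv G a - 1) * (deriv G y * (y - a) ^ 2) := by
          have : 0 ≤ deriv G a - 1 := by linarith
          positivity
        nlinarith
      have h6 : deriv G y / (G y - a) ^ 2 ≤ 1 / (y - a) ^ 2 := by
        rw [div_le_div_iff₀ (by positivity) (by positivity)]
        exact h5
      rw [neg_div, neg_div]
      linarith
  refine ⟨(p + b) / 2, ⟨by linarith, by linarith⟩, ?_⟩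
  have m : (p + b) / 2 ∈ Icc p b := ⟨by linarith, by linarith⟩
  have l1 := hanti ⟨le_rfl, hpb.le⟩ m m.1
  have l2 := hanti m ⟨hpb.le, le_rfl⟩ m.2
  simp only [hp, hb, sub_self] at l1 l2
  have := inv_injective (sub_eq_zero.mp (le_antisymm l1 l2))
  linarith

theorem critical_point_or_unbounded_basin (f : ℝ → ℝ) (n : ℕ) (p : ℝ)
    (hf : ContDiff ℝ 1 f) (hnc : NowhereCoexpanding f)
    (hn : 0 < n) (hper : f^[n] p = p)
    (hattr : Basin f n p ∈ nhds p) :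
    ¬ Bornology.IsBounded (connectedComponentIn (Basin f n p) p) ∨
      ∃ c : ℝ, deriv f c = 0 ∧ ∃ m : ℕ, m < n ∧
        Tendsto (fun k : ℕ => f^[n * k] c) atTop (nhds (f^[m] p)) := by
  by_contra hcon
  push Not at hcon
  obtain ⟨hbd, hcrit⟩ := hcon
  have hcont : ∀ j, Continuous f^[j] := fun j => hf.continuous.iterate j
  have hd : Differentiable ℝ f := hf.differentiable (by norm_num)
  have hcd : ∀ j, ContDiff ℝ 1 f^[j] := by
    intro j
    induction j with
    | zero => exact contDiff_id
    | succ j ih => rw [Function.iterate_succ']; exact hf.comp ih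
  -- invariance
  have hinv : ∀ x, f^[n] x ∈ Basin f n p ↔ x ∈ Basin f n p := by
    intro x
    unfold Basin
    simp only [mem_setOf_eq]
    rw [← tendsto_add_atTop_iff_nat (f := fun k => f^[n * k] x) 1]
    simp only [mul_add, mul_one, Function.iterate_add_apply]
  have hpB : p ∈ Basin f n p := mem_of_mem_nhds hattr
  have hopen : IsOpen (Basin f n p) := by
    rw [isOpen_iff_mem_nhds]
    intro x hx
    obtain ⟨k, hk⟩ := (hx.eventually hattr).exists
    have h1 : ∀ k y, f^[n * k] y ∈ Basin f n p ↔ y ∈ Basin f n p := by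
      intro k
      induction k with
      | zero => intro y; simp
      | succ k ih =>
        intro y
        rw [mul_add, mul_one, Function.iterate_add_apply, ih, hinv]
    obtain ⟨V, hVs, hVo, hpV⟩ := mem_nhds_iff.mp hattr
    obtain ⟨k, hk⟩ := (hx.eventually (hVo.mem_nhds hpV)).exists
    filter_upwards [(hcont (n * k)).continuousAt.preimage_mem_nhds (hVo.mem_nhds hk)] with y hy
    exact (h1 k y).mp (hVs hy)
  set B := connectedComponentIn (Basin f n p) p with hBdef
  have hBsub : B ⊆ Basin f n p := connectedComponentIn_subset _ _
  have hBo : IsOpen B := hopen.connectedComponentIn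
  have hBp : IsPreconnected B := isPreconnected_connectedComponentIn
  have hpm : p ∈ B := mem_connectedComponentIn hpB
  have hmax : ∀ T : Set ℝ, IsPreconnected T → (∃ x ∈ B, x ∈ T) → T ⊆ Basin f n p → T ⊆ B := by
    rintro T hT ⟨x, hxB, hxT⟩ hTs
    rw [hBdef, connectedComponentIn_eq hxB]
    exact hT.subset_connectedComponentIn hxT hTs
  have hgB : ∀ x ∈ B, f^[n] x ∈ B := by
    have := hmax (f^[n] '' B) (hBp.image _ (hcont n).continuousOn) ⟨p, hpm, p, hpm, hper⟩
      (by rintro _ ⟨x, hx, rfl⟩; exact (hinv x).mpr (hBsub hx))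
    exact fun x hx => this ⟨x, hx, rfl⟩
  have hBS : ∀ j : ℕ, ∀ z ∈ B, deriv f (f^[j] z) ≠ 0 := by
    intro j z hz h0
    refine hcrit _ h0 (j % n) (Nat.mod_lt _ hn) ?_
    have hP : Function.IsPeriodicPt f n p := hper
    rw [hP.iterate_mod_apply j]
    have h1 := ((hcont j).tendsto p).comp (hBsub hz)
    refine h1.congr fun k => ?_
    simp only [Function.comp]
    rw [← Function.iterate_add_apply, ← Function.iterate_add_apply, add_comm]
  -- endpoints
  set a := sInf B with hadef
  set b := sSup B with hbdef
  have hbb : BddBelow B := hbd.bddBelow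
  have hba : BddAbove B := hbd.bddAbove
  have hne : B.Nonempty := ⟨p, hpm⟩
  have haB : a ∉ B := fun h => by
    obtain ⟨l, hl, hl2⟩ := exists_Ioc_subset_of_mem_nhds (hBo.mem_nhds h) ⟨a - 1, by linarith⟩
    have := csInf_le hbb (hl2 ⟨by linarith, by linarith⟩ : (l + a) / 2 ∈ B)
    linarith
  have hbB : b ∉ B := fun h => by
    obtain ⟨l, hl, hl2⟩ := exists_Ico_subset_of_mem_nhds (hBo.mem_nhds h) ⟨b + 1, by linarith⟩
    have := le_csSup hba (hl2 ⟨by linarith, by linarith⟩ : (l + b) / 2 ∈ B)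
    linarith
  have hBI : B = Ioo a b := by
    apply Subset.antisymm
    · intro x hx
      refine ⟨lt_of_le_of_ne (csInf_le hbb hx) ?_, lt_of_le_of_ne (le_csSup hba hx) ?_⟩
      · intro h; exact haB (h ▸ hx)
      · intro h; exact hbB (h ▸ hx)
    · exact (IsConnected.Ioo_csInf_csSup_subset ⟨hne, hBp⟩ hbb hba)
  have hpI : p ∈ Ioo a b := hBI ▸ hpm
  have hab : a < b := hpI.1.trans hpI.2
  have haN : a ∉ Basin f n p := fun h => haB <| by
    refine hmax (Ico a b) isPreconnected_Ico ⟨p, hpm, hpI.1.le, hpI.2⟩ ?_ ⟨le_rfl, hab⟩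
    intro x hx
    rcases hx.1.eq_or_lt with e | e
    · exact e ▸ h
    · exact hBsub (hBI ▸ ⟨e, hx.2⟩)
  have hbN : b ∉ Basin f n p := fun h => hbB <| by
    refine hmax (Ioc a b) isPreconnected_Ioc ⟨p, hpm, hpI.1, hpI.2.le⟩ ?_ ⟨hab, le_rfl⟩
    intro x hx
    rcases hx.2.eq_or_lt with e | e
    · exact e.symm ▸ h
    · exact hBsub (hBI ▸ ⟨hx.1, e⟩)
  have hGit : ∀ x, f^[n + n] x = f^[n] (f^[n] x) := fun x => Function.iterate_add_apply f n n x
  have hGB : ∀ x ∈ B, f^[n + n] x ∈ B := fun x hx => by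
    rw [hGit]; exact hgB _ (hgB _ hx)
  have hGN : ∀ x, x ∉ Basin f n p → f^[n + n] x ∉ Basin f n p := fun x hx => by
    rw [hGit, hinv, hinv]; exact hx
  have hGcl : ∀ x ∈ Icc a b, f^[n + n] x ∈ Icc a b := by
    have hm : MapsTo f^[n + n] (closure B) (closure B) :=
      MapsTo.closure hGB (hcont _)
    rw [hBI, closure_Ioo hab.ne] at hm
    exact hm
  have hend : ∀ x ∈ Icc a b, x ∉ Basin f n p → f^[n + n] x = a ∨ f^[n + n] x = b := by
    intro x hx hxN
    have h1 := hGcl x hx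
    have h2 : f^[n + n] x ∉ Ioo a b := fun h => hGN x hxN (hBsub (hBI ▸ h))
    by_contra! h3
    exact h2 ⟨lt_of_le_of_ne h1.1 h3.1.symm, lt_of_le_of_ne h1.2 h3.2⟩
  have hpos : ∀ x ∈ Ioo a b, 0 < deriv f^[n + n] x := by
    intro x hx
    rw [← hBI] at hx
    have := (iter_aux f hf hnc B hBp hBS n _ (hgB x hx) x hx).1
    rw [Function.iterate_add, deriv_comp x ((hd.iterate n) _) ((hd.iterate n) x)]
    exact this
  have hmono : StrictMonoOn f^[n + n] (Icc a b) := by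
    apply strictMonoOn_of_deriv_pos (convex_Icc a b) (hcont _).continuousOn
    rw [interior_Icc]; exact hpos
  have hlt := hmono ⟨le_rfl, hab.le⟩ ⟨hab.le, le_rfl⟩ hab
  have hGab : f^[n + n] a = a ∧ f^[n + n] b = b := by
    have h1 := hGcl a ⟨le_rfl, hab.le⟩
    have h2 := hGcl b ⟨hab.le, le_rfl⟩
    rcases hend a ⟨le_rfl, hab.le⟩ haN with e | e <;>
      rcases hend b ⟨hab.le, le_rfl⟩ hbN with e' | e'
    · linarith
    · exact ⟨e, e'⟩
    · linarith
    · linarith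
  have hGlim : ∀ x ∈ Ioo a b, Tendsto (fun k => (f^[n + n])^[k] x) atTop (nhds p) := by
    intro x hx
    have h1 : Tendsto (fun k => f^[n * k] x) atTop (nhds p) := hBsub (hBI ▸ hx)
    have h2 : Tendsto (fun k : ℕ => 2 * k) atTop atTop :=
      tendsto_id.const_mul_atTop' (by norm_num)
    refine (h1.comp h2).congr fun k => ?_
    simp only [Function.comp]
    rw [← Function.iterate_mul, show n * (2 * k) = (n + n) * k by ring]
  have hlow : ∀ x ∈ Ioo a p, x ≤ f^[n + n] x := by
    intro x hx
    by_contra! hlt'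
    have hxI : x ∈ Ioo a b := ⟨hx.1, hx.2.trans hpI.2⟩
    have hk : ∀ k, (f^[n + n])^[k] x ∈ Icc a b ∧ (f^[n + n])^[k] x ≤ x := by
      intro k
      induction k with
      | zero => exact ⟨⟨hxI.1.le, hxI.2.le⟩, le_rfl⟩
      | succ k ih =>
        rw [Function.iterate_succ_apply']
        exact ⟨hGcl _ ih.1,
          (hmono.monotoneOn ih.1 ⟨hxI.1.le, hxI.2.le⟩ ih.2).trans hlt'.le⟩
    have := le_of_tendsto' (hGlim x hxI) (fun k => (hk k).2)
    linarith [hx.2]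
  obtain ⟨q, hq, hGq⟩ := real_aux f^[n + n] (hcd _) a p b hpI.1 hpI.2 hGab.1
    (by rw [hGit, hper, hper]) hGab.2 hlow hmono
    (fun x hx y hy => (iter_aux f hf hnc B hBp hBS (n + n) x (hBI ▸ hx) y (hBI ▸ hy)).2) hpos
  have h1 := hGlim q ⟨hpI.1.trans hq.1, hq.2⟩
  have h2 : ∀ k, (f^[n + n])^[k] q = q := fun k => Function.iterate_fixed hGq k
  simp only [h2] at h1
  have := tendsto_nhds_unique h1 tendsto_const_nhds
  linarith [hq.1]
end

section
/- If f : ℝ → ℝ and g : ℝ → ℝ are C¹ nowhere coexpanding functions, then the composition g ∘ f is nowhere coexpanding. That is, the class F of nowhere coexpanding functions is closed under composition. -/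
open Set

theorem nce_sign (h : ℝ → ℝ) (hc : Continuous h) (S : Set ℝ) (hS : IsPreconnected S)
    (h0 : ∀ z ∈ S, h z ≠ 0) (x y : ℝ) (hx : x ∈ S) (hy : y ∈ S) : 0 ≤ h x * h y := by
  by_contra hneg
  push Not at hneg
  have key : ∀ a ∈ S, ∀ b ∈ S, h a < 0 → 0 < h b → False := by
    intro a ha b hb h1 h2
    obtain ⟨z, hz, hz0⟩ := hS.intermediate_value ha hb hc.continuousOn ⟨h1.le, h2.le⟩
    exact h0 z hz hz0
  rcases mul_neg_iff.mp hneg with ⟨h1, h2⟩ | ⟨h1, h2⟩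
  · exact key y hy x hx h2 h1
  · exact key x hx y hy h1 h2

theorem nowhereCoexpanding_comp (f g : ℝ → ℝ)
    (hf : ContDiff ℝ 1 f) (hg : ContDiff ℝ 1 g)
    (hncf : NowhereCoexpanding f) (hncg : NowhereCoexpanding g) :
    NowhereCoexpanding (g ∘ f) := by
  intro x y hxy hy
  have hd : ∀ z, deriv (g ∘ f) z = deriv g (f z) * deriv f z := fun z =>
    deriv_comp z (hg.differentiable one_ne_zero _) (hf.differentiable one_ne_zero _)
  have hxU : x ∈ {z : ℝ | deriv (g ∘ f) z ≠ 0} := by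
    by_contra h
    rw [connectedComponentIn_eq_empty h] at hy
    exact hy
  have hxS := mem_connectedComponentIn hxU
  have hS : IsPreconnected (connectedComponentIn {z : ℝ | deriv (g ∘ f) z ≠ 0} x) :=
    isPreconnected_connectedComponentIn
  have hsub := connectedComponentIn_subset {z : ℝ | deriv (g ∘ f) z ≠ 0} x
  generalize connectedComponentIn {z : ℝ | deriv (g ∘ f) z ≠ 0} x = S at *
  have hSf : ∀ z ∈ S, deriv f z ≠ 0 := fun z hz h => hsub hz (by rw [hd, h, mul_zero])
  have hSg : ∀ z ∈ S, deriv g (f z) ≠ 0 := fun z hz h => hsub hz (by rw [hd, h, zero_mul])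
  have cf := hf.continuous_deriv le_rfl
  have cg := hg.continuous_deriv le_rfl
  have pf := nce_sign _ cf S hS hSf x y hxS hy
  have pg := nce_sign _ (cg.comp hf.continuous) S hS hSg x y hxS hy
  simp only [Function.comp_apply] at pg ⊢
  rw [hd, hd]
  by_cases hfe : f x = f y
  · simp [hfe]
  have A := hncf x y hxy (hS.subset_connectedComponentIn hxS hSf hy)
  have B := hncg (f x) (f y) hfe
    ((hS.image f hf.continuous.continuousOn).subset_connectedComponentIn (mem_image_of_mem f hxS)
      (by rintro _ ⟨z, hz, rfl⟩; exact hSg z hz) (mem_image_of_mem f hy))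
  have hne : f x - f y ≠ 0 := sub_ne_zero.mpr hfe
  have e : (x - y) / (g (f x) - g (f y))
      = (x - y) / (f x - f y) * ((f x - f y) / (g (f x) - g (f y))) := by
    rw [div_mul_div_cancel₀ hne]
  have := mul_le_one₀ A (mul_nonneg pg (sq_nonneg _)) B
  rw [e]
  calc _ = _ := by ring
    _ ≤ 1 := this
end

section
/- Let f : ℝ → ℝ and g : ℝ → ℝ be C¹ nowhere coexpanding functions and set h = g ∘ f. If I ⊆ ℝ is an interval on which h has no critical points (h'(x) ≠ 0 for all x ∈ I), then for any distinct x₁, x₂ ∈ I one has χ_h(x₁, x₂) = h'(x₁)·h'(x₂)·((x₁−x₂)/(h(x₁)−h(x₂)))² ≤ 1. -/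
open Set

theorem chi_comp_le_one (f g : ℝ → ℝ)
    (hf : ContDiff ℝ 1 f) (hg : ContDiff ℝ 1 g)
    (hncf : NowhereCoexpanding f) (hncg : NowhereCoexpanding g)
    (I : Set ℝ) (hI : I.OrdConnected)
    (hreg : ∀ x ∈ I, deriv (g ∘ f) x ≠ 0)
    (x₁ x₂ : ℝ) (hx₁ : x₁ ∈ I) (hx₂ : x₂ ∈ I) (hne : x₁ ≠ x₂) :
    deriv (g ∘ f) x₁ * deriv (g ∘ f) x₂ *
      ((x₁ - x₂) / ((g ∘ f) x₁ - (g ∘ f) x₂)) ^ 2 ≤ 1 := by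
  have hfd : Differentiable ℝ f := hf.differentiable (by norm_num)
  have hgd : Differentiable ℝ g := hg.differentiable (by norm_num)
  have hch : ∀ x, deriv (g ∘ f) x = deriv g (f x) * deriv f x := fun x =>
    deriv_comp x (hgd (f x)) (hfd x)
  have hIp : IsPreconnected I := hI.isPreconnected
  have hcf : Continuous (deriv f) := hf.continuous_deriv (by norm_num)
  have h1 : ∀ x ∈ I, deriv f x ≠ 0 := fun x hx h0 => hreg x hx (by rw [hch, h0, mul_zero])
  have h2 : ∀ x ∈ I, deriv g (f x) ≠ 0 := fun x hx h0 => hreg x hx (by rw [hch, h0, zero_mul])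
  by_cases hfe : f x₁ = f x₂
  · simp [hfe]
  have hb := hncf x₁ x₂ hne
    (hIp.subset_connectedComponentIn hx₁ (fun x hx => h1 x hx) hx₂)
  have hsub : f '' I ⊆ {z : ℝ | deriv g z ≠ 0} := by
    rintro _ ⟨x, hx, rfl⟩
    exact h2 x hx
  have ha := hncg (f x₁) (f x₂) hfe
    ((hIp.image f hfd.continuous.continuousOn).subset_connectedComponentIn
      (mem_image_of_mem f hx₁) hsub (mem_image_of_mem f hx₂))
  have hpos : 0 ≤ deriv f x₁ * deriv f x₂ := by
    by_contra hlt
    push Not at hlt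
    have hoc := (hIp.image (deriv f) hcf.continuousOn).ordConnected
    have m1 := mem_image_of_mem (deriv f) hx₁
    have m2 := mem_image_of_mem (deriv f) hx₂
    have h0 : (0 : ℝ) ∈ deriv f '' I := by
      rcases mul_neg_iff.mp hlt with h | h
      · exact hoc.out m2 m1 ⟨h.2.le, h.1.le⟩
      · exact hoc.out m1 m2 ⟨h.1.le, h.2.le⟩
    obtain ⟨x, hx, hx0⟩ := h0
    exact h1 x hx hx0
  have hb0 : 0 ≤ deriv f x₁ * deriv f x₂ * ((x₁ - x₂) / (f x₁ - f x₂)) ^ 2 :=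
    mul_nonneg hpos (sq_nonneg _)
  have hd : f x₁ - f x₂ ≠ 0 := sub_ne_zero.mpr hfe
  have key : (x₁ - x₂) / ((g ∘ f) x₁ - (g ∘ f) x₂) =
      (f x₁ - f x₂) / (g (f x₁) - g (f x₂)) * ((x₁ - x₂) / (f x₁ - f x₂)) := by
    rw [mul_comm, div_mul_div_cancel₀ hd]; rfl
  rw [hch, hch, key]
  calc _ = (deriv g (f x₁) * deriv g (f x₂) * ((f x₁ - f x₂) / (g (f x₁) - g (f x₂))) ^ 2) *
        (deriv f x₁ * deriv f x₂ * ((x₁ - x₂) / (f x₁ - f x₂)) ^ 2) := by ring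
    _ ≤ 1 * (deriv f x₁ * deriv f x₂ * ((x₁ - x₂) / (f x₁ - f x₂)) ^ 2) :=
        mul_le_mul_of_nonneg_right ha hb0
    _ ≤ 1 := by rw [one_mul]; exact hb
end

section
/- Let f : ℝ → ℝ be a C¹ nowhere coexpanding function such that Fix(f) = {x : f(x) = x} has empty interior. If a < b < c are fixed points of f and the open interval (a, c) contains no critical points of f, then f'(b) > 1. -/
open Set

theorem middle_fixed_point_expanding (f : ℝ → ℝ)
    (hf : ContDiff ℝ 1 f) (hnc : NowhereCoexpanding f)
    (hint : interior {x : ℝ | f x = x} = ∅)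
    (a b c : ℝ) (hab : a < b) (hbc : b < c)
    (hfa : f a = a) (hfb : f b = b) (hfc : f c = c)
    (hreg : ∀ x ∈ Ioo a c, deriv f x ≠ 0) :
    1 < deriv f b := by
  have hd : Differentiable ℝ f := hf.differentiable (by norm_num)
  have hcont : Continuous f := hd.continuous
  have hac : a < c := hab.trans hbc
  have hpos : ∀ x ∈ Ioo a c, 0 < deriv f x := by
    obtain ⟨z, hz, hz1⟩ := exists_deriv_eq_slope f hac hcont.continuousOn hd.differentiableOn
    rw [hfa, hfc, div_self (by linarith)] at hz1
    have := hasDerivWithinAt_forall_lt_or_forall_gt_of_forall_ne (convex_Ioo a c)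
      (fun x _ => (hd x).hasDerivAt.hasDerivWithinAt) hreg
    rcases this with h | h
    · have := h z hz
      linarith
    · exact h
  have hmono : StrictMonoOn f (Icc a c) := by
    apply strictMonoOn_of_deriv_pos (convex_Icc a c) hcont.continuousOn
    rwa [interior_Icc]
  have key : ∀ x ∈ Ioo a c, ∀ y ∈ Ioo a c, x ≠ y →
      deriv f x * deriv f y * (x - y) ^ 2 ≤ (f x - f y) ^ 2 := by
    intro x hx y hy hxy
    have h1 := hnc x y hxy
      (isPreconnected_Ioo.subset_connectedComponentIn hx (fun z hz => hreg z hz) hy)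
    have hne : f x - f y ≠ 0 := fun h =>
      hxy (hmono.injOn (Ioo_subset_Icc_self hx) (Ioo_subset_Icc_self hy) (by linarith))
    have hp : 0 < (f x - f y) ^ 2 := by positivity
    rw [div_pow, ← mul_div_assoc, div_le_one hp] at h1
    exact h1
  -- step 1
  have s1 : ∀ y ∈ Ioo b c, deriv f y * ((y - a) * (y - b)) ≤ (f y - a) * (f y - b) := by
    intro y hy
    have hy' : y ∈ Ioo a c := ⟨hab.trans hy.1, hy.2⟩
    have hm := hpos y hy'
    have hlt : ∀ x ∈ Icc a b, f x < f y := fun x hx =>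
      hmono ⟨hx.1, by linarith [hx.2]⟩ (Ioo_subset_Icc_self hy') (by linarith [hx.2, hy.1])
    have hD : ∀ x ∈ Icc a b, HasDerivAt (fun x => (f x - f y)⁻¹ - (deriv f y * (x - y))⁻¹)
        (-deriv f x / (f x - f y) ^ 2 - -(deriv f y * 1) / (deriv f y * (x - y)) ^ 2) x := by
      intro x hx
      have h1 := hlt x hx
      have h2 : x - y < 0 := by linarith [hx.2, hy.1]
      exact (((hd x).hasDerivAt.sub_const (f y)).inv (by linarith)).sub
        ((((hasDerivAt_id x).sub_const y).const_mul (deriv f y)).inv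
          (mul_ne_zero hm.ne' h2.ne))
    have hM : MonotoneOn (fun x => (f x - f y)⁻¹ - (deriv f y * (x - y))⁻¹) (Icc a b) := by
      apply monotoneOn_of_deriv_nonneg (convex_Icc a b)
        (fun x hx => (hD x hx).continuousAt.continuousWithinAt)
      · intro x hx
        exact (hD x (interior_subset hx)).differentiableAt.differentiableWithinAt
      · intro x hx
        rw [(hD x (interior_subset hx)).deriv]
        rw [interior_Icc] at hx
        have h1 := hlt x (Ioo_subset_Icc_self hx)
        have h2 : x - y < 0 := by linarith [hx.2, hy.1]
        have hk := key x ⟨hx.1, by linarith [hx.2]⟩ y hy' (by linarith)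
        have hp : 0 < (f x - f y) ^ 2 := by nlinarith
        have hq : 0 < (x - y) ^ 2 := by nlinarith
        have e : -deriv f x / (f x - f y) ^ 2 - -(deriv f y * 1) / (deriv f y * (x - y)) ^ 2
          = ((f x - f y) ^ 2 - deriv f x * deriv f y * (x - y) ^ 2) /
            (deriv f y * (f x - f y) ^ 2 * (x - y) ^ 2) := by
          have := h2.ne
          have : f x - f y ≠ 0 := by linarith
          field_simp
          ring
        rw [e]
        apply div_nonneg (by linarith) (by positivity)
    have h := hM ⟨le_rfl, hab.le⟩ ⟨hab.le, le_rfl⟩ hab.le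
    simp only [hfa, hfb] at h
    have hb := hlt b ⟨hab.le, le_rfl⟩
    rw [hfb] at hb
    have p1 : 0 < f y - b := by linarith
    have p2 : 0 < f y - a := by linarith
    have p3 : 0 < y - b := by linarith [hy.1]
    have p4 : 0 < y - a := by linarith [hy.1]
    have e : (b - f y)⁻¹ - (deriv f y * (b - y))⁻¹ - ((a - f y)⁻¹ - (deriv f y * (a - y))⁻¹)
      = (b - a) * ((f y - a) * (f y - b) - deriv f y * ((y - a) * (y - b))) /
        (deriv f y * (f y - a) * (f y - b) * (y - a) * (y - b)) := by
      rw [← neg_sub (f y) b, ← neg_sub (f y) a, ← neg_sub y b, ← neg_sub y a]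
      field_simp
      ring
    have h0 := sub_nonneg.2 h
    rw [e] at h0
    by_contra hcon
    push Not at hcon
    have : (b - a) * ((f y - a) * (f y - b) - deriv f y * ((y - a) * (y - b))) < 0 :=
      mul_neg_of_pos_of_neg (by linarith) (by linarith)
    have := div_neg_of_neg_of_pos this
      (show 0 < deriv f y * (f y - a) * (f y - b) * (y - a) * (y - b) by positivity)
    linarith
  -- step 2
  have hgt : ∀ y ∈ Icc b c, a < f y := fun y hy => by
    have := hmono ⟨le_rfl, hac.le⟩ ⟨by linarith [hy.1], hy.2⟩ (show a < y by linarith [hy.1])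
    rwa [hfa] at this
  have hGD : ∀ y ∈ Ioo b c, HasDerivAt (fun y => dslope f b y * (y - a) / (f y - a))
      ((b - a) * (deriv f y * ((y - a) * (y - b)) - (f y - a) * (f y - b)) /
        ((f y - a) * (y - b)) ^ 2) y := by
    intro y hy
    have h1 : f y - a ≠ 0 := by linarith [hgt y (Ioo_subset_Icc_self hy)]
    have h2 : y - b ≠ 0 := by linarith [hy.1]
    have h3 := (((hd y).hasDerivAt.sub_const b).mul ((hasDerivAt_id y).sub_const a)).div
      (((hd y).hasDerivAt.sub_const a).mul ((hasDerivAt_id y).sub_const b)) (mul_ne_zero h1 h2)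
    have h4 := h3.congr_of_eventuallyEq (f₁ := fun y => dslope f b y * (y - a) / (f y - a)) (by
      filter_upwards [Ioo_mem_nhds hy.1 hy.2] with z hz
      have h1 : f z - a ≠ 0 := by linarith [hgt z (Ioo_subset_Icc_self hz)]
      have h2 : z - b ≠ 0 := by linarith [hz.1]
      simp only [Pi.div_apply, Pi.mul_apply, id]
      rw [dslope_of_ne _ (by linarith [hz.1]), slope_def_field, hfb]
      field_simp)
    refine h4.congr_deriv ?_
    simp only [Pi.mul_apply, id]
    congr 1
    ring
  have hGA : AntitoneOn (fun y => dslope f b y * (y - a) / (f y - a)) (Icc b c) := by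
    apply antitoneOn_of_deriv_nonpos (convex_Icc b c)
    · have hds : Continuous (dslope f b) := by
        rw [continuous_iff_continuousAt]
        intro x
        by_cases hx : x = b
        · subst hx
          exact continuousAt_dslope_same.2 (hd x)
        · exact (continuousAt_dslope_of_ne hx).2 hcont.continuousAt
      exact ContinuousOn.div (by fun_prop) (by fun_prop) (fun y hy => by linarith [hgt y hy])
    · intro x hx
      rw [interior_Icc] at hx
      exact (hGD x hx).differentiableAt.differentiableWithinAt
    · intro x hx
      rw [interior_Icc] at hx
      rw [(hGD x hx).deriv]
      apply div_nonpos_of_nonpos_of_nonneg _ (by positivity)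
      apply mul_nonpos_of_nonneg_of_nonpos (by linarith)
      linarith [s1 x hx]
  by_contra hcon
  push Not at hcon
  have hid : Ioo b c ⊆ {x | f x = x} := by
    intro y hy
    have g1 := hGA ⟨le_rfl, hbc.le⟩ (Ioo_subset_Icc_self hy) hy.1.le
    have g2 := hGA (Ioo_subset_Icc_self hy) ⟨hbc.le, le_rfl⟩ hy.2.le
    have q1 : b - a ≠ 0 := by linarith
    have q2 : c - a ≠ 0 := by linarith
    have q3 : c - b ≠ 0 := by linarith
    have h1 : f y - a ≠ 0 := by linarith [hgt y (Ioo_subset_Icc_self hy)]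
    have h2 : y - b ≠ 0 := by linarith [hy.1]
    simp only [dslope_same, hfb, mul_div_assoc, div_self q1, mul_one] at g1
    simp only [dslope_of_ne f hbc.ne', slope_def_field, hfb, hfc, mul_div_assoc,
      div_self q2, div_self q3, mul_one] at g2
    have g3 := le_antisymm (g1.trans hcon) g2
    rw [dslope_of_ne f hy.1.ne', slope_def_field, hfb] at g3
    field_simp at g3
    have : (b - a) * (f y - y) = 0 := by linarith
    have := (mul_eq_zero.1 this).resolve_left q1
    show f y = y
    linarith
  have := interior_maximal hid isOpen_Ioo
  rw [hint] at this
  exact this (show (b + c) / 2 ∈ Ioo b c from ⟨by linarith, by linarith⟩)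
end

section
/- Let f : ℝ → ℝ be a C¹ nowhere coexpanding function with no critical points (f'(x) ≠ 0 for all x). If the fixed point set Fix(f) = {x : f(x) = x} has empty interior, then f has at most three fixed points. -/
open Set

theorem aux_pos (f : ℝ → ℝ) (hf : ContDiff ℝ 1 f) (hreg : ∀ x : ℝ, deriv f x ≠ 0)
    {a b : ℝ} (hab : a < b) (ha : f a = a) (hb : f b = b) : ∀ x, 0 < deriv f x := by
  have hd : Differentiable ℝ f := hf.differentiable (by norm_num)
  have hc : Continuous (deriv f) := hf.continuous_deriv (by norm_num)
  obtain ⟨c, _, hcc⟩ := exists_deriv_eq_slope f hab hd.continuous.continuousOn hd.differentiableOn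
  have h1 : deriv f c = 1 := by
    rw [hcc, ha, hb]; exact div_self (by linarith)
  intro x
  by_contra hx
  have : (0:ℝ) ∈ Set.range (deriv f) :=
    mem_range_of_exists_le_of_exists_ge hc ⟨x, not_lt.mp hx⟩ ⟨c, by rw [h1]; norm_num⟩
  obtain ⟨z, hz⟩ := this
  exact hreg z hz

theorem aux_chi (f : ℝ → ℝ) (hnc : NowhereCoexpanding f) (hpos : ∀ x : ℝ, 0 < deriv f x)
    {x y : ℝ} (hxy : x ≠ y) : deriv f x * deriv f y * (x - y) ^ 2 ≤ (f x - f y) ^ 2 := by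
  have hu : {z : ℝ | deriv f z ≠ 0} = univ := by
    ext z; simp [(hpos z).ne']
  have hm : f x ≠ f y := fun h => hxy ((strictMono_of_deriv_pos hpos).injective h)
  have h := hnc x y hxy (by
    rw [hu, connectedComponentIn_univ, PreconnectedSpace.connectedComponent_eq_univ]; trivial)
  have h2 : 0 < (f x - f y) ^ 2 := by
    have := sub_ne_zero.mpr hm
    positivity
  rw [div_pow, ← mul_div_assoc, div_le_one h2] at h
  exact h

theorem aux_ineq (f : ℝ → ℝ) (hf : ContDiff ℝ 1 f) (hnc : NowhereCoexpanding f)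
    (hpos : ∀ x : ℝ, 0 < deriv f x)
    {p q x : ℝ} (hpq : p < q) (hp : f p = p) (hq : f q = q) (hx : x ∉ Icc p q) :
    deriv f x * ((x - p) * (x - q)) ≤ (f x - p) * (f x - q) := by
  have hd : Differentiable ℝ f := hf.differentiable (by norm_num)
  have hmono := strictMono_of_deriv_pos hpos
  have hne : ∀ y ∈ Icc p q, x - y ≠ 0 := fun y hy h => hx (by rwa [sub_eq_zero.mp h])
  have hne' : ∀ y ∈ Icc p q, f x - f y ≠ 0 := fun y hy h =>
    hne y hy (sub_eq_zero.mpr (hmono.injective (sub_eq_zero.mp h)))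
  have hk := hpos x
  have hder : ∀ y ∈ Icc p q, HasDerivAt
      (fun y => (f x - f y)⁻¹ - (deriv f x)⁻¹ * (x - y)⁻¹)
      (-(-deriv f y) / (f x - f y) ^ 2 - (deriv f x)⁻¹ * (-(-1) / (x - y) ^ 2)) y := by
    intro y hy
    have h1 : HasDerivAt (fun y => f x - f y) (-deriv f y) y :=
      (hd y).hasDerivAt.const_sub (f x)
    have h2 : HasDerivAt (fun y => x - y) (-1) y := (hasDerivAt_id y).const_sub x
    exact (h1.fun_inv (hne' y hy)).sub ((h2.fun_inv (hne y hy)).const_mul _)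
  have hanti : AntitoneOn (fun y => (f x - f y)⁻¹ - (deriv f x)⁻¹ * (x - y)⁻¹) (Icc p q) := by
    apply antitoneOn_of_deriv_nonpos (convex_Icc p q)
    · exact fun y hy => (hder y hy).continuousAt.continuousWithinAt
    · exact fun y hy => (hder y (interior_subset hy)).differentiableAt.differentiableWithinAt
    · intro y hy
      have hy' := interior_subset hy
      rw [(hder y hy').deriv]
      have h1 := hne y hy'
      have h2 := hne' y hy'
      have h3 := aux_chi f hnc hpos (sub_ne_zero.mp h1)
      have e1 : 0 < (x - y) ^ 2 := by positivity
      have e2 : 0 < (f x - f y) ^ 2 := by positivity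
      have : deriv f y / (f x - f y) ^ 2 ≤ 1 / (deriv f x * (x - y) ^ 2) := by
        rw [div_le_div_iff₀ e2 (by positivity)]
        linarith
      have e3 : (deriv f x)⁻¹ * (-(-1) / (x - y) ^ 2) = 1 / (deriv f x * (x - y) ^ 2) := by
        field_simp
        try norm_num
      rw [e3, neg_neg]
      linarith
  have hP : p ∈ Icc p q := ⟨le_rfl, hpq.le⟩
  have hQ : q ∈ Icc p q := ⟨hpq.le, le_rfl⟩
  have h := hanti hP hQ hpq.le
  simp only [hp, hq] at h
  have a1 := hne p hP
  have a2 := hne q hQ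
  have a3 := hne' p hP
  have a4 := hne' q hQ
  rw [hp] at a3
  rw [hq] at a4
  have s : 0 < (x - p) * (x - q) ∧ 0 < (f x - p) * (f x - q) := by
    rcases lt_or_ge x p with h1 | h1
    · have := hmono h1
      rw [hp] at this
      constructor <;> apply mul_pos_of_neg_of_neg <;> linarith
    · have h2 : q < x := by
        by_contra h2
        exact hx ⟨h1, not_lt.mp h2⟩
      have := hmono h2
      rw [hq] at this
      constructor <;> apply mul_pos <;> linarith
  obtain ⟨s1, s2⟩ := s
  have e1 : (f x - q)⁻¹ - (f x - p)⁻¹ = (q - p) / ((f x - p) * (f x - q)) := by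
    field_simp
    ring
  have e2 : (deriv f x)⁻¹ * (x - q)⁻¹ - (deriv f x)⁻¹ * (x - p)⁻¹
      = (q - p) / (deriv f x * ((x - p) * (x - q))) := by
    field_simp
    ring
  have h5 : (q - p) / ((f x - p) * (f x - q)) ≤ (q - p) / (deriv f x * ((x - p) * (x - q))) := by
    rw [← e1, ← e2]; linarith
  rwa [div_le_div_iff_of_pos_left (by linarith) s2 (by positivity)] at h5

theorem aux_four (f : ℝ → ℝ)
    (hf : ContDiff ℝ 1 f) (hnc : NowhereCoexpanding f)
    (hreg : ∀ x : ℝ, deriv f x ≠ 0)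
    (hint : interior {x : ℝ | f x = x} = ∅) {a b c d : ℝ} (hab : a < b) (hbc : b < c) (hcd : c < d)
    (ha : f a = a) (hb : f b = b) (hc : f c = c) (hd : f d = d) : False := by
  have hpos := aux_pos f hf hreg hab ha hb
  have hdf : Differentiable ℝ f := hf.differentiable (by norm_num)
  have hmono := strictMono_of_deriv_pos hpos
  have hcont : ContinuousOn (fun y => f y - y) (Icc b c) :=
    (hdf.continuous.sub continuous_id).continuousOn
  have hne : (Icc b c).Nonempty := nonempty_Icc.mpr hbc.le
  have hder : ∀ y, HasDerivAt (fun y => f y - y) (deriv f y - 1) y := fun y =>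
    (hdf y).hasDerivAt.sub (hasDerivAt_id y)
  have hbd : ∀ y ∈ Icc b c, f y - y ≠ 0 → y ∈ Ioo b c := by
    intro y hy h
    refine ⟨lt_of_le_of_ne hy.1 ?_, lt_of_le_of_ne hy.2 ?_⟩
    · rintro rfl; exact h (by linarith)
    · rintro rfl; exact h (by linarith)
  have hup : ∀ y ∈ Icc b c, f y - y ≤ 0 := by
    obtain ⟨m, hm, hmax⟩ := isCompact_Icc.exists_isMaxOn hne hcont
    intro y hy
    by_contra hy0
    have h1 : f y - y ≤ f m - m := hmax hy
    have h0 : 0 < f m - m := by linarith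
    have hmI := hbd m hm h0.ne'
    have hd0 := (hmax.isLocalMax (Icc_mem_nhds hmI.1 hmI.2)).hasDerivAt_eq_zero (hder m)
    have h2 := aux_ineq f hf hnc hpos hcd hc hd (x := m) (fun h => absurd h.1 (not_le.mpr hmI.2))
    have h3 : deriv f m = 1 := by linarith
    have h4 := hmono hmI.2
    rw [hc] at h4
    rw [h3] at h2
    nlinarith [hmI.2]
  have hlo : ∀ y ∈ Icc b c, 0 ≤ f y - y := by
    obtain ⟨m, hm, hmin⟩ := isCompact_Icc.exists_isMinOn hne hcont
    intro y hy
    by_contra hy0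
    have h1 : f m - m ≤ f y - y := hmin hy
    have h0 : f m - m < 0 := by linarith
    have hmI := hbd m hm h0.ne
    have hd0 := (hmin.isLocalMin (Icc_mem_nhds hmI.1 hmI.2)).hasDerivAt_eq_zero (hder m)
    have h2 := aux_ineq f hf hnc hpos hab ha hb (x := m) (fun h => absurd h.2 (not_le.mpr hmI.1))
    have h3 : deriv f m = 1 := by linarith
    have h4 := hmono hmI.1
    rw [hb] at h4
    rw [h3] at h2
    nlinarith [hmI.1]
  have hsub : Ioo b c ⊆ interior {x : ℝ | f x = x} := by
    apply interior_maximal _ isOpen_Ioo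
    intro y hy
    have h1 := hup y ⟨hy.1.le, hy.2.le⟩
    have h2 := hlo y ⟨hy.1.le, hy.2.le⟩
    show f y = y
    linarith
  rw [hint] at hsub
  exact hsub (show (b + c) / 2 ∈ Ioo b c from ⟨by linarith, by linarith⟩)

theorem at_most_three_fixed_points (f : ℝ → ℝ)
    (hf : ContDiff ℝ 1 f) (hnc : NowhereCoexpanding f)
    (hreg : ∀ x : ℝ, deriv f x ≠ 0)
    (hint : interior {x : ℝ | f x = x} = ∅) :
    ({x : ℝ | f x = x}).encard ≤ 3 := by
  by_contra hcon
  have h4 : (4 : ℕ∞) ≤ ({x : ℝ | f x = x}).encard := by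
    have := Order.add_one_le_of_lt (not_le.mp hcon)
    have e : (3 : ℕ∞) + 1 = 4 := by norm_num
    rwa [e] at this
  obtain ⟨t, ht, htc⟩ := Set.exists_subset_encard_eq h4
  have hfin : t.Finite := Set.finite_of_encard_eq_coe (k := 4) htc
  have hcard : hfin.toFinset.card = 4 := by
    rw [hfin.encard_eq_coe_toFinset_card] at htc
    exact_mod_cast htc
  let e := hfin.toFinset.orderEmbOfFin hcard
  have hfix : ∀ i, f (e i) = e i := fun i =>
    ht (hfin.mem_toFinset.mp (Finset.orderEmbOfFin_mem _ hcard i))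
  have hlt : ∀ i j : Fin 4, i < j → e i < e j := fun i j h => e.strictMono h
  exact aux_four f hf hnc hreg hint (hlt 0 1 (by decide)) (hlt 1 2 (by decide))
    (hlt 2 3 (by decide)) (hfix 0) (hfix 1) (hfix 2) (hfix 3)
end

section
/- Let f : ℝ → ℝ be a C¹ nowhere coexpanding function with no critical points (f'(x) ≠ 0 for all x). If the fixed point set Fix(f) = {x : f(x) = x} has non-empty interior, then f'(x) ≤ 1 for all x ∈ ℝ. -/
open Set

theorem deriv_le_one_of_fix_interior (f : ℝ → ℝ)
    (hf : ContDiff ℝ 1 f) (hnc : NowhereCoexpanding f)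
    (hreg : ∀ x : ℝ, deriv f x ≠ 0)
    (hint : (interior {x : ℝ | f x = x}).Nonempty) :
    ∀ x : ℝ, deriv f x ≤ 1 := by
  have hd : Differentiable ℝ f := hf.differentiable (by norm_num)
  have hc : Continuous (deriv f) := hf.continuous_deriv (by norm_num)
  obtain ⟨a, ha⟩ := hint
  have hev : ∀ᶠ t in nhds a, f t = t := mem_interior_iff_mem_nhds.mp ha
  have hfa : f a = a := hev.self_of_nhds
  have hda : deriv f a = 1 := by
    have h : f =ᶠ[nhds a] id := hev
    rw [h.deriv_eq]; simp
  have hpos : ∀ x, 0 < deriv f x := by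
    intro x
    by_contra hx
    obtain ⟨z, hz⟩ := mem_range_of_exists_le_of_exists_ge hc ⟨x, not_lt.mp hx⟩
      ⟨a, by rw [hda]; norm_num⟩
    exact hreg z hz
  have hm : StrictMono f := strictMono_of_deriv_pos hpos
  have huniv : {z : ℝ | deriv f z ≠ 0} = Set.univ := by
    ext z; simp [hreg z]
  have key : ∀ t, t ≠ a → deriv f t / (f t - a) ^ 2 ≤ 1 / (t - a) ^ 2 := by
    intro t ht
    have h := hnc t a ht (by rw [huniv, connectedComponentIn_univ]; simp)
    rw [hda, hfa, div_pow] at h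
    have h1 : f t - a ≠ 0 := by
      rw [sub_ne_zero]; intro h2; exact ht (hm.injective (h2.trans hfa.symm))
    have h2 : t - a ≠ 0 := sub_ne_zero.mpr ht
    have h3 : 0 < (f t - a) ^ 2 := by positivity
    have h4 : 0 < (t - a) ^ 2 := by positivity
    rw [div_le_div_iff₀ h3 h4]
    rw [mul_one, ← mul_div_assoc, div_le_one h3] at h
    linarith
  have hφ : ∀ t, t ≠ a → HasDerivAt (fun t => (t - a)⁻¹ - (f t - a)⁻¹)
      (-1 / (t - a) ^ 2 - -(deriv f t) / (f t - a) ^ 2) t := by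
    intro t ht
    have h1 : f t - a ≠ 0 := by
      rw [sub_ne_zero]; intro h2; exact ht (hm.injective (h2.trans hfa.symm))
    have h2 : t - a ≠ 0 := sub_ne_zero.mpr ht
    exact (((hasDerivAt_id t).sub_const a).inv h2).sub
      (((hd t).hasDerivAt.sub_const a).inv h1)
  have anti : ∀ s : Set ℝ, Convex ℝ s → (∀ t ∈ s, t ≠ a) →
      AntitoneOn (fun t => (t - a)⁻¹ - (f t - a)⁻¹) s := by
    intro s hs hsa
    apply antitoneOn_of_deriv_nonpos hs
    · intro t ht; exact (hφ t (hsa t ht)).continuousAt.continuousWithinAt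
    · intro t ht
      exact (hφ t (hsa t (interior_subset ht))).differentiableAt.differentiableWithinAt
    · intro t ht
      have hta := hsa t (interior_subset ht)
      rw [(hφ t hta).deriv]
      have := key t hta
      rw [neg_div, neg_div]; linarith
  have fin : ∀ x, x ≠ a → (f x - a) ^ 2 ≤ (x - a) ^ 2 → deriv f x ≤ 1 := by
    intro x hx h
    have h1 : f x - a ≠ 0 := by
      rw [sub_ne_zero]; intro h2; exact hx (hm.injective (h2.trans hfa.symm))
    have h2 : x - a ≠ 0 := sub_ne_zero.mpr hx
    have h3 : 0 < (f x - a) ^ 2 := by positivity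
    have h4 : 0 < (x - a) ^ 2 := by positivity
    have := key x hx
    rw [div_le_div_iff₀ h3 h4] at this
    by_contra hlt
    nlinarith
  obtain ⟨ε, hε, hball⟩ := Metric.eventually_nhds_iff.mp hev
  intro x
  rcases lt_trichotomy x a with hx | hx | hx
  · have hfx : f x < a := by rw [← hfa]; exact hm hx
    apply fin x hx.ne
    obtain ⟨b, hb1, hb2⟩ := exists_between (max_lt hx (show a - ε < a by linarith))
    have hb3 := (le_max_left _ _).trans hb1.le
    have hb4 := (le_max_right _ _).trans_lt hb1
    have hb : f b = b := hball (by rw [Real.dist_eq, abs_lt]; constructor <;> linarith)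
    have h := anti (Set.Iio a) (convex_Iio a) (fun t ht => ne_of_lt ht) hx hb2 hb3
    simp only [hb, sub_self, sub_nonneg] at h
    rw [inv_le_inv_of_neg (by linarith) (by linarith)] at h
    nlinarith
  · rw [hx, hda]
  · have hfx : a < f x := by rw [← hfa]; exact hm hx
    apply fin x hx.ne'
    obtain ⟨b, hb1, hb2⟩ := exists_between (lt_min hx (show a < a + ε by linarith))
    have hb3 := hb2.le.trans (min_le_left _ _)
    have hb4 := hb2.trans_le (min_le_right _ _)
    have hb : f b = b := hball (by rw [Real.dist_eq, abs_lt]; constructor <;> linarith)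
    have h := anti (Set.Ioi a) (convex_Ioi a) (fun t ht => ne_of_gt ht) hb1 hx hb3
    simp only [hb, sub_self, sub_nonpos] at h
    rw [inv_le_inv₀ (by linarith) (by linarith)] at h
    nlinarith
end

section
/- Let f : ℝ → ℝ be a C³ function with fixed points a < b (f(a) = a, f(b) = b) such that f has no critical point in the open interval (a, b). If f'(a) > 1 and f'(b) > 1, then there exists p ∈ (a, b) such that S_f(p) > 0. -/
open Set

theorem exists_pos_schwarzian (f : ℝ → ℝ) (hf : ContDiff ℝ 3 f)
    (a b : ℝ) (hab : a < b) (hfa : f a = a) (hfb : f b = b)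
    (hreg : ∀ x ∈ Ioo a b, deriv f x ≠ 0)
    (hda : 1 < deriv f a) (hdb : 1 < deriv f b) :
    ∃ p ∈ Ioo a b, 0 < schwarzian f p := by
  by_contra! hS
  have h0 : Differentiable ℝ f := hf.differentiable (by norm_num)
  have h1 : ∀ x, HasDerivAt (deriv f) (iteratedDeriv 2 f x) x := by
    intro x
    have h := (hf.differentiable_iteratedDeriv 1 (by norm_cast)) x
    rw [iteratedDeriv_succ (n := 1)]
    rw [iteratedDeriv_one] at h ⊢
    exact h.hasDerivAt
  have h2 : ∀ x, HasDerivAt (iteratedDeriv 2 f) (iteratedDeriv 3 f x) x := by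
    intro x
    have h := (hf.differentiable_iteratedDeriv 2 (by norm_cast)) x
    rw [iteratedDeriv_succ (n := 2)]
    exact h.hasDerivAt
  have hc : Continuous (deriv f) := continuous_iff_continuousAt.2 fun x => (h1 x).continuousAt
  have hpos : ∀ x ∈ Icc a b, 0 < deriv f x := by
    intro x hx
    rcases eq_or_lt_of_le hx.2 with h | h
    · subst h; linarith
    by_contra! hneg
    obtain ⟨y, hy, hy0⟩ := intermediate_value_Icc' hx.1 hc.continuousOn
      (show (0 : ℝ) ∈ Icc (deriv f x) (deriv f a) from ⟨hneg, by linarith⟩)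
    have hya : y ≠ a := by rintro rfl; linarith
    exact hreg y ⟨lt_of_le_of_ne hy.1 hya.symm, lt_of_le_of_lt hy.2 h⟩ hy0
  set g : ℝ → ℝ := fun x => Real.exp (-(1 / 2) * Real.log (deriv f x)) with hg
  have hg1 : ∀ x ∈ Icc a b,
      HasDerivAt g (g x * (-(1 / 2) * (iteratedDeriv 2 f x / deriv f x))) x := fun x hx =>
    (((h1 x).log (hpos x hx).ne').const_mul (-(1 / 2))).exp
  have hg2 : ∀ x ∈ Icc a b,
      HasDerivAt (fun x => g x * (-(1 / 2) * (iteratedDeriv 2 f x / deriv f x)))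
        (g x * (-(1 / 2) * schwarzian f x)) x := by
    intro x hx
    have hx0 := (hpos x hx).ne'
    refine ((hg1 x hx).mul (((h2 x).div (h1 x) hx0).const_mul (-(1 / 2)))).congr_deriv ?_
    unfold schwarzian
    simp only [Pi.div_apply]
    field_simp
    ring
  have hconv : ConvexOn ℝ (Icc a b) g := by
    apply convexOn_of_hasDerivWithinAt2_nonneg (convex_Icc a b)
      (f' := fun x => g x * (-(1 / 2) * (iteratedDeriv 2 f x / deriv f x)))
      (f'' := fun x => g x * (-(1 / 2) * schwarzian f x))
    · exact fun x hx => (hg1 x hx).continuousAt.continuousWithinAt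
    · exact fun x hx => (hg1 x (interior_subset hx)).hasDerivWithinAt
    · exact fun x hx => (hg2 x (interior_subset hx)).hasDerivWithinAt
    · intro x hx
      rw [interior_Icc] at hx
      have := hS x hx
      exact mul_nonneg (Real.exp_pos _).le (by linarith)
  obtain ⟨c, hcm, hc1⟩ := exists_deriv_eq_slope f hab h0.continuous.continuousOn
    h0.differentiableOn
  rw [hfa, hfb, div_self (by linarith)] at hc1
  have hgc : g c = 1 := by simp [hg, hc1]
  have hlt : ∀ x, 1 < deriv f x → g x < 1 := by
    intro x hx
    have := Real.log_pos hx
    refine lt_of_lt_of_eq ?_ Real.exp_zero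
    exact Real.exp_lt_exp.2 (by linarith)
  have := hconv.le_max_of_mem_Icc (left_mem_Icc.2 hab.le) (right_mem_Icc.2 hab.le)
    (Ioo_subset_Icc_self hcm)
  have := max_lt (hlt a hda) (hlt b hdb)
  linarith
end

section
/- Let f : ℝ → ℝ and g : ℝ → ℝ be glueable nowhere coexpanding functions, and define (f ⋆ g)(x) = f(x) for x ≤ 0 and (f ⋆ g)(x) = g(x) for x ≥ 0 (note f(0) = g(0) = 0, so this is well defined, and f'(0) = g'(0) = 1 makes f ⋆ g a C¹ function). Then f ⋆ g is nowhere coexpanding. -/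
open Set

/-- A nowhere coexpanding function is glueable if `f'(0) = 1` and `|f x| ≤ |x|` on the
connected component of `ℝ \ Crit f` containing `0`. -/
def Glueable (f : ℝ → ℝ) : Prop :=
  NowhereCoexpanding f ∧ deriv f 0 = 1 ∧
    ∀ x ∈ connectedComponentIn {z : ℝ | deriv f z ≠ 0} 0, |f x| ≤ |x|

lemma mem_cc_iff (S : Set ℝ) (x y : ℝ) : y ∈ connectedComponentIn S x ↔ uIcc x y ⊆ S := by
  constructor
  · intro h
    have hx : x ∈ S := connectedComponentIn_nonempty_iff.1 ⟨y, h⟩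
    exact (isPreconnected_connectedComponentIn.ordConnected.uIcc_subset
      (mem_connectedComponentIn hx) h).trans (connectedComponentIn_subset S x)
  · intro h
    exact isPreconnected_uIcc.subset_connectedComponentIn left_mem_uIcc h right_mem_uIcc

lemma side_bound (f : ℝ → ℝ) (hf : ContDiff ℝ 1 f) (h : Glueable f) (x : ℝ) (hx : x ≠ 0)
    (hs : uIcc 0 x ⊆ {z : ℝ | deriv f z ≠ 0}) :
    0 < deriv f x ∧ 0 < f x / x ∧ f x / x ≤ 1 ∧ deriv f x ≤ (f x / x) ^ 2 := by
  obtain ⟨h1, h2, h3⟩ := h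
  have f0 : f 0 = 0 := by
    have := h3 0 (by rw [mem_cc_iff]; intro z hz; simp at hz; subst hz; simp [h2])
    simpa using this
  have hc : Continuous (deriv f) := hf.continuous_deriv le_rfl
  have hd : Differentiable ℝ f := hf.differentiable one_ne_zero
  have hpos : ∀ z ∈ uIcc 0 x, 0 < deriv f z := by
    intro z hz
    by_contra hn
    push Not at hn
    have := intermediate_value_uIcc (a := 0) (b := z) hc.continuousOn
    have h0 : (0 : ℝ) ∈ uIcc (deriv f 0) (deriv f z) := by
      rw [h2, mem_uIcc]; right; exact ⟨hn, zero_le_one⟩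
    obtain ⟨w, hw, hw0⟩ := this h0
    exact hs (uIcc_subset_uIcc_left hz hw) hw0
  have hq : 0 < f x / x := by
    rcases lt_or_gt_of_ne hx with hl | hl
    · obtain ⟨c, hc1, hc2⟩ := exists_deriv_eq_slope f hl hd.continuous.continuousOn hd.differentiableOn
      have := hpos c (by rw [mem_uIcc]; right; exact ⟨hc1.1.le, hc1.2.le⟩)
      rw [hc2, f0] at this
      simpa [neg_div_neg_eq] using this
    · obtain ⟨c, hc1, hc2⟩ := exists_deriv_eq_slope f hl hd.continuous.continuousOn hd.differentiableOn
      have := hpos c (by rw [mem_uIcc]; left; exact ⟨hc1.1.le, hc1.2.le⟩)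
      rw [hc2, f0] at this
      simpa using this
  refine ⟨hpos x right_mem_uIcc, hq, ?_, ?_⟩
  · have := h3 x ((mem_cc_iff _ _ _).2 hs)
    rw [← abs_of_pos hq, abs_div]
    exact div_le_one_of_le₀ this (abs_nonneg _)
  · have := h1 0 x hx.symm ((mem_cc_iff _ _ _).2 hs)
    rw [h2, f0, one_mul, zero_sub, zero_sub, neg_div_neg_eq] at this
    have e : (x / f x) = (f x / x)⁻¹ := by rw [inv_div]
    rw [e, inv_pow, ← div_eq_mul_inv, div_le_one (by positivity)] at this
    exact this

theorem glue_nowhereCoexpanding (f g : ℝ → ℝ)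
    (hf : ContDiff ℝ 1 f) (hg : ContDiff ℝ 1 g)
    (hgf : Glueable f) (hgg : Glueable g) :
    NowhereCoexpanding (fun x : ℝ => if x ≤ 0 then f x else g x) := by
  have zero : ∀ k : ℝ → ℝ, Glueable k → k 0 = 0 := by
    rintro k ⟨h1, h2, h3⟩
    have := h3 0 (by rw [mem_cc_iff]; intro z hz; simp at hz; subst hz; simp [h2])
    simpa using this
  have f0 := zero f hgf
  have g0 := zero g hgg
  have hdf : Differentiable ℝ f := hf.differentiable one_ne_zero
  have hdg : Differentiable ℝ g := hg.differentiable one_ne_zero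
  set h : ℝ → ℝ := fun x : ℝ => if x ≤ 0 then f x else g x with hh
  have hL : ∀ x ≤ 0, h x = f x := fun x hx => by simp [hh, hx]
  have hR : ∀ x, 0 ≤ x → h x = g x := fun x hx => by
    rcases hx.eq_or_lt with rfl | hx
    · simp [hh, f0, g0]
    · simp [hh, not_le.2 hx]
  have d0 : deriv h 0 = 1 := by
    have a : HasDerivWithinAt h 1 (Iic 0) 0 := by
      have := (hdf 0).hasDerivAt.hasDerivWithinAt (s := Iic 0)
      rw [hgf.2.1] at this
      exact this.congr (fun x hx => hL x hx) (hL 0 le_rfl)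
    have b : HasDerivWithinAt h 1 (Ici 0) 0 := by
      have := (hdg 0).hasDerivAt.hasDerivWithinAt (s := Ici 0)
      rw [hgg.2.1] at this
      exact this.congr (fun x hx => hR x hx) (hR 0 le_rfl)
    have := a.union b
    rw [Iic_union_Ici, hasDerivWithinAt_univ] at this
    exact this.deriv
  have dL : ∀ x ≤ 0, deriv h x = deriv f x := by
    intro x hx
    rcases hx.eq_or_lt with rfl | hx
    · rw [d0, hgf.2.1]
    · apply Filter.EventuallyEq.deriv_eq
      filter_upwards [Iio_mem_nhds hx] with z hz using hL z (le_of_lt hz)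
  have dR : ∀ x, 0 ≤ x → deriv h x = deriv g x := by
    intro x hx
    rcases hx.eq_or_lt with rfl | hx
    · rw [d0, hgg.2.1]
    · apply Filter.EventuallyEq.deriv_eq
      filter_upwards [Ioi_mem_nhds hx] with z hz using hR z (le_of_lt hz)
  have key : ∀ x y : ℝ, x < y → uIcc x y ⊆ {z : ℝ | deriv h z ≠ 0} →
      deriv h x * deriv h y * ((x - y) / (h x - h y)) ^ 2 ≤ 1 := by
    intro x y hxy hs
    rcases le_or_gt y 0 with hy | hy
    · rw [dL x (hxy.le.trans hy), dL y hy, hL x (hxy.le.trans hy), hL y hy]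
      refine hgf.1 x y hxy.ne ((mem_cc_iff _ _ _).2 fun z hz => ?_)
      have := hs hz
      rw [uIcc_of_le hxy.le] at hz
      simpa [dL z (hz.2.trans hy)] using this
    rcases le_or_gt 0 x with hx | hx
    · rw [dR x hx, dR y hy.le, hR x hx, hR y hy.le]
      refine hgg.1 x y hxy.ne ((mem_cc_iff _ _ _).2 fun z hz => ?_)
      have := hs hz
      rw [uIcc_of_le hxy.le] at hz
      simpa [dR z (hx.trans hz.1)] using this
    rw [dL x hx.le, dR y hy.le, hL x hx.le, hR y hy.le]
    rw [uIcc_of_le hxy.le] at hs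
    obtain ⟨p1, p2, p3, p4⟩ := side_bound f hf hgf x hx.ne (fun z hz => by
      rw [uIcc_of_ge hx.le] at hz
      have := hs ⟨hz.1, hz.2.trans hy.le⟩
      simpa [dL z hz.2] using this)
    obtain ⟨q1, q2, q3, q4⟩ := side_bound g hg hgg y hy.ne' (fun z hz => by
      rw [uIcc_of_le hy.le] at hz
      have := hs ⟨hx.le.trans hz.1, hz.2⟩
      simpa [dR z hz.1] using this)
    obtain ⟨s, hs'⟩ : ∃ s, s = f x / x := ⟨_, rfl⟩
    obtain ⟨t, ht'⟩ : ∃ t, t = g y / y := ⟨_, rfl⟩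
    rw [← hs'] at p2 p3 p4
    rw [← ht'] at q2 q3 q4
    have ex : f x = s * x := by rw [hs', div_mul_cancel₀ _ hx.ne]
    have ey : g y = t * y := by rw [ht', div_mul_cancel₀ _ hy.ne']
    rw [ex, ey]
    have hden : s * x - t * y < 0 := by nlinarith [mul_pos p2 (neg_pos.2 hx), mul_pos q2 hy]
    have hr : 0 ≤ (x - y) / (s * x - t * y) := div_nonneg_of_nonpos (by linarith) hden.le
    have hr1 : s * t * ((x - y) / (s * x - t * y)) ≤ 1 := by
      rw [← mul_div_assoc, div_le_one_of_neg hden]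
      nlinarith [mul_nonneg (mul_nonneg p2.le (neg_pos.2 hx).le) (sub_nonneg.2 q3),
        mul_nonneg (mul_nonneg q2.le hy.le) (sub_nonneg.2 p3)]
    calc deriv f x * deriv g y * ((x - y) / (s * x - t * y)) ^ 2
        ≤ s ^ 2 * t ^ 2 * ((x - y) / (s * x - t * y)) ^ 2 := by gcongr
      _ = (s * t * ((x - y) / (s * x - t * y))) ^ 2 := by ring
      _ ≤ 1 := pow_le_one₀ (by positivity) hr1
  intro x y hne hy
  rw [mem_cc_iff] at hy
  rcases lt_or_gt_of_ne hne with hlt | hlt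
  · exact key x y hlt hy
  · have := key y x hlt (by rwa [uIcc_comm])
    rw [← neg_sub x y, ← neg_sub (h x) (h y), neg_div_neg_eq, mul_comm (deriv h y)] at this
    exact this
end

section
/- The hyperbolic tangent function tanh : ℝ → ℝ is nowhere coexpanding; since tanh has no critical points, this means that for all distinct x, y ∈ ℝ, tanh'(x)·tanh'(y)·((x−y)/(tanh(x)−tanh(y)))² ≤ 1. -/
open Set

lemma deriv_tanh_aux (x : ℝ) : deriv Real.tanh x = 1 / Real.cosh x ^ 2 := by
  have h : Real.tanh = fun x => Real.sinh x / Real.cosh x := by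
    funext x
    exact Real.tanh_eq_sinh_div_cosh x
  rw [h]
  have hd := (Real.hasDerivAt_sinh x).div (Real.hasDerivAt_cosh x) (Real.cosh_pos x).ne'
  have hd2 : deriv (fun x => Real.sinh x / Real.cosh x) x = _ := hd.deriv
  rw [hd2]
  congr 1
  have := Real.cosh_sq x
  nlinarith

lemma tanh_chi_aux (x y : ℝ) (hxy : x ≠ y) :
    deriv Real.tanh x * deriv Real.tanh y *
      ((x - y) / (Real.tanh x - Real.tanh y)) ^ 2 ≤ 1 := by
  have hx := (Real.cosh_pos x).ne'
  have hy := (Real.cosh_pos y).ne'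
  have hs : Real.sinh (x - y) ≠ 0 := by
    rw [Ne, Real.sinh_eq_zero]
    exact sub_ne_zero.mpr hxy
  have ht : Real.tanh x - Real.tanh y = Real.sinh (x - y) / (Real.cosh x * Real.cosh y) := by
    rw [Real.tanh_eq_sinh_div_cosh, Real.tanh_eq_sinh_div_cosh, Real.sinh_sub]
    field_simp
  have he : deriv Real.tanh x * deriv Real.tanh y *
      ((x - y) / (Real.tanh x - Real.tanh y)) ^ 2 = (x - y) ^ 2 / Real.sinh (x - y) ^ 2 := by
    rw [deriv_tanh_aux, deriv_tanh_aux, ht]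
    field_simp
  rw [he, div_le_one (by positivity)]
  rcases le_total 0 (x - y) with h | h
  · have := Real.self_le_sinh_iff.mpr h
    nlinarith
  · have := Real.sinh_le_self_iff.mpr h
    nlinarith

theorem tanh_nowhereCoexpanding :
    NowhereCoexpanding Real.tanh ∧
      ∀ x y : ℝ, x ≠ y →
        deriv Real.tanh x * deriv Real.tanh y *
          ((x - y) / (Real.tanh x - Real.tanh y)) ^ 2 ≤ 1 :=
  ⟨fun x y h _ => tanh_chi_aux x y h, tanh_chi_aux⟩
end

section
/- The ELU function, defined by ELU(x) = x for x ≥ 0 and ELU(x) = eˣ − 1 for x ≤ 0, is a C¹ function with no critical points and is nowhere coexpanding; i.e. for all distinct x, y ∈ ℝ, ELU'(x)·ELU'(y)·((x−y)/(ELU(x)−ELU(y)))² ≤ 1. -/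
open Set

/-- The ELU activation function. -/
noncomputable def ELU (x : ℝ) : ℝ := if 0 ≤ x then x else Real.exp x - 1

theorem elu_key {x y : ℝ} (h : x ≤ y) :
    Real.exp (x/2) * Real.exp (y/2) * (y - x) ≤ Real.exp y - Real.exp x := by
  have h1 : (y - x)/2 ≤ Real.sinh ((y - x)/2) := Real.self_le_sinh_iff.2 (by linarith)
  rw [Real.sinh_eq] at h1
  have h2 : y - x ≤ Real.exp ((y - x)/2) - Real.exp (-((y - x)/2)) := by linarith
  have h3 := mul_le_mul_of_nonneg_left h2
    (mul_pos (Real.exp_pos (x/2)) (Real.exp_pos (y/2))).le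
  refine h3.trans (le_of_eq ?_)
  rw [mul_sub, ← Real.exp_add, ← Real.exp_add, ← Real.exp_add]
  congr 2 <;> ring

theorem elu_hasDerivAt (x : ℝ) : HasDerivAt ELU (Real.exp (min x 0)) x := by
  have he : ∀ z : ℝ, HasDerivAt (fun t : ℝ => Real.exp t - 1) (Real.exp z) z :=
    fun z => (Real.hasDerivAt_exp z).sub_const 1
  rcases lt_trichotomy x 0 with h | h | h
  · rw [min_eq_left h.le]
    refine (he x).congr_of_eventuallyEq ?_
    filter_upwards [Iio_mem_nhds h] with t ht
    simp [ELU, not_le.2 (mem_Iio.1 ht)]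
  · subst h
    rw [min_self]
    have h1 : HasDerivWithinAt ELU (Real.exp 0) (Iic 0) 0 := by
      refine (he 0).hasDerivWithinAt.congr_of_mem (fun t ht => ?_) (by simp)
      rcases eq_or_lt_of_le (mem_Iic.1 ht) with h | h
      · simp [ELU, h]
      · simp [ELU, not_le.2 h]
    have h2 : HasDerivWithinAt ELU (Real.exp 0) (Ici 0) 0 := by
      rw [Real.exp_zero]
      refine (hasDerivAt_id (0:ℝ)).hasDerivWithinAt.congr_of_mem (fun t ht => ?_) (by simp)
      simp [ELU, mem_Ici.1 ht]
    have := h1.union h2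
    rwa [Iic_union_Ici, hasDerivWithinAt_univ] at this
  · rw [min_eq_right h.le, Real.exp_zero]
    refine (hasDerivAt_id x).congr_of_eventuallyEq ?_
    filter_upwards [Ioi_mem_nhds h] with t ht
    simp [ELU, (mem_Ioi.1 ht).le]

theorem elu_key2 {x y : ℝ} (h : x < y) :
    Real.exp (min x 0/2) * Real.exp (min y 0/2) * (y - x) ≤ ELU y - ELU x := by
  rcases le_or_gt 0 x with hx | hx
  · have hy : 0 ≤ y := by linarith
    simp [ELU, hx, hy]
  · rcases le_or_gt 0 y with hy | hy
    · have k := elu_key hx.le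
      have hs : Real.exp (x/2) ≤ 1 := Real.exp_le_one_iff.2 (by linarith)
      simp only [ELU, hy, not_le.2 hx, min_eq_left hx.le, min_eq_right hy, if_true, if_false,
        zero_div, Real.exp_zero] at k ⊢
      nlinarith
    · have k := elu_key h.le
      simp only [ELU, not_le.2 hy, not_le.2 hx, min_eq_left hx.le, min_eq_left hy.le, if_false]
      linarith

theorem elu_chi {x y : ℝ} (h : x < y) :
    Real.exp (min x 0) * Real.exp (min y 0) * ((x - y) / (ELU x - ELU y)) ^ 2 ≤ 1 := by
  have k := elu_key2 h
  have hp : 0 < Real.exp (min x 0/2) * Real.exp (min y 0/2) * (y - x) := by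
    have : 0 < y - x := by linarith
    positivity
  have e : ∀ z : ℝ, Real.exp z = Real.exp (z/2) ^ 2 := fun z => by
    rw [← Real.exp_nat_mul]; congr 1; push_cast; ring
  rw [e (min x 0), e (min y 0), ← mul_pow, ← mul_pow, ← neg_sub y x, ← neg_sub (ELU y), neg_div_neg_eq,
    ← mul_div_assoc]
  have hE := hp.trans_le k
  exact pow_le_one₀ (div_nonneg hp.le hE.le) ((div_le_one hE).2 k)

theorem elu_nowhereCoexpanding :
    ContDiff ℝ 1 ELU ∧ (∀ x : ℝ, deriv ELU x ≠ 0) ∧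
      ∀ x y : ℝ, x ≠ y →
        deriv ELU x * deriv ELU y * ((x - y) / (ELU x - ELU y)) ^ 2 ≤ 1 := by
  have hd : deriv ELU = fun x => Real.exp (min x 0) := funext fun x => (elu_hasDerivAt x).deriv
  refine ⟨?_, ?_, ?_⟩
  · rw [contDiff_one_iff_deriv, hd]
    exact ⟨fun x => (elu_hasDerivAt x).differentiableAt, by fun_prop⟩
  · intro x
    rw [hd]
    exact (Real.exp_pos _).ne'
  · intro x y hxy
    rw [hd]
    rcases lt_or_gt_of_ne hxy with h | h
    · exact elu_chi h
    · have := elu_chi h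
      rw [← neg_sub x y, ← neg_sub (ELU x), neg_div_neg_eq] at this
      rwa [mul_comm (Real.exp _)] at this
end

section
/- The logistic sigmoid function σ(x) = 1/(1 + e^{−x}) is nowhere coexpanding; since σ has no critical points, this means that for all distinct x, y ∈ ℝ, σ'(x)·σ'(y)·((x−y)/(σ(x)−σ(y)))² ≤ 1. -/
open Set

/-- The logistic sigmoid function. -/
noncomputable def logisticSigmoid (x : ℝ) : ℝ := 1 / (1 + Real.exp (-x))

theorem logisticSigmoid_deriv_aux (x : ℝ) :
    deriv logisticSigmoid x = Real.exp (-x) / (1 + Real.exp (-x)) ^ 2 := by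
  have hpos : 1 + Real.exp (-x) ≠ 0 := by positivity
  have h1 : HasDerivAt (fun z : ℝ => 1 + Real.exp (-z)) (Real.exp (-x) * (-1)) x :=
    ((hasDerivAt_id x).neg.exp).const_add 1
  have h2 := h1.inv hpos
  have h3 : logisticSigmoid = (fun z : ℝ => 1 + Real.exp (-z))⁻¹ := by
    funext z
    simp [logisticSigmoid]
  rw [h3, h2.deriv]
  ring

theorem exp_sq_aux (x y : ℝ) :
    Real.exp (-x) * Real.exp (-y) * (x - y) ^ 2 ≤ (Real.exp (-x) - Real.exp (-y)) ^ 2 := by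
  have hs : ((x - y) / 2) ^ 2 ≤ Real.sinh ((x - y) / 2) ^ 2 := by
    rw [sq_le_sq, Real.abs_sinh]
    exact Real.self_le_sinh_iff.2 (abs_nonneg _)
  have hE : (Real.exp (-x) - Real.exp (-y)) ^ 2
      = Real.exp (-x) * Real.exp (-y) * (4 * Real.sinh ((x - y) / 2) ^ 2) := by
    rw [Real.sinh_eq]
    have e1 : Real.exp (-x) = Real.exp (-x / 2) ^ 2 := by
      rw [← Real.exp_nat_mul]; congr 1; push_cast; ring
    have e2 : Real.exp (-y) = Real.exp (-y / 2) ^ 2 := by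
      rw [← Real.exp_nat_mul]; congr 1; push_cast; ring
    have e3 : Real.exp ((x - y) / 2) = Real.exp (-y / 2) / Real.exp (-x / 2) := by
      rw [← Real.exp_sub]; congr 1; ring
    have e4 : Real.exp (-((x - y) / 2)) = Real.exp (-x / 2) / Real.exp (-y / 2) := by
      rw [← Real.exp_sub]; congr 1; ring
    rw [e1, e2, e3, e4]
    have := Real.exp_pos (-x / 2)
    have := Real.exp_pos (-y / 2)
    field_simp
    ring
  rw [hE]
  apply mul_le_mul_of_nonneg_left _ (by positivity)
  linarith

theorem logisticSigmoid_chi_aux (x y : ℝ) (hxy : x ≠ y) :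
    deriv logisticSigmoid x * deriv logisticSigmoid y *
      ((x - y) / (logisticSigmoid x - logisticSigmoid y)) ^ 2 ≤ 1 := by
  have key := exp_sq_aux x y
  have hne : Real.exp (-x) - Real.exp (-y) ≠ 0 := by
    intro h
    exact hxy (neg_injective (Real.exp_injective (sub_eq_zero.1 h)))
  rw [logisticSigmoid_deriv_aux, logisticSigmoid_deriv_aux]
  unfold logisticSigmoid
  have ha := Real.exp_pos (-x)
  have hb := Real.exp_pos (-y)
  generalize Real.exp (-x) = a at *
  generalize Real.exp (-y) = b at *
  have hd : 1 / (1 + a) - 1 / (1 + b) = -(a - b) / ((1 + a) * (1 + b)) := by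
    field_simp
    ring
  have : a / (1 + a) ^ 2 * (b / (1 + b) ^ 2) * ((x - y) / (1 / (1 + a) - 1 / (1 + b))) ^ 2
      = a * b * (x - y) ^ 2 / (a - b) ^ 2 := by
    rw [hd]
    field_simp
  rw [this, div_le_one (by positivity)]
  exact key

theorem logisticSigmoid_nowhereCoexpanding :
    NowhereCoexpanding logisticSigmoid ∧
      ∀ x y : ℝ, x ≠ y →
        deriv logisticSigmoid x * deriv logisticSigmoid y *
          ((x - y) / (logisticSigmoid x - logisticSigmoid y)) ^ 2 ≤ 1 := by
  exact ⟨fun x y h _ => logisticSigmoid_chi_aux x y h, logisticSigmoid_chi_aux⟩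
end

section
/- The function f(x) = tanh(4x) + tanh(x/4) is not nowhere coexpanding: f has no critical points (f'(x) > 0 for all x), yet there exist distinct x, y ∈ ℝ with f'(x)·f'(y)·((x−y)/(f(x)−f(y)))² > 1. In particular, the class of nowhere coexpanding functions is not closed under addition, since tanh(4x) and tanh(x/4) are each nowhere coexpanding. -/
open Set

lemma aux_hasDerivAt_tanh (x : ℝ) : HasDerivAt Real.tanh (1 / Real.cosh x ^ 2) x := by
  have h := (Real.hasDerivAt_sinh x).div (Real.hasDerivAt_cosh x) (Real.cosh_pos x).ne'
  have e : Real.tanh = Real.sinh / Real.cosh := by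
    funext t
    simp [Real.tanh_eq_sinh_div_cosh]
  rw [e]
  refine h.congr_deriv ?_
  congr 1
  have := Real.cosh_sq x
  linarith [sq (Real.cosh x), sq (Real.sinh x)]

lemma aux_deriv_scaled (a x : ℝ) :
    HasDerivAt (fun t : ℝ => Real.tanh (a * t)) (a / Real.cosh (a * x) ^ 2) x := by
  have h := (aux_hasDerivAt_tanh (a * x)).comp x ((hasDerivAt_id x).const_mul a)
  refine h.congr_deriv ?_
  ring

lemma aux_sq_le_sinh_sq (w : ℝ) : w ^ 2 ≤ Real.sinh w ^ 2 := by
  rcases le_total 0 w with h | h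
  · exact pow_le_pow_left₀ h (Real.self_le_sinh_iff.2 h) 2
  · have := Real.sinh_le_self_iff.2 h
    nlinarith

lemma aux_nowhere (a : ℝ) : NowhereCoexpanding (fun t : ℝ => Real.tanh (a * t)) := by
  intro x y _ _
  rw [(aux_deriv_scaled a x).deriv, (aux_deriv_scaled a y).deriv]
  have hx := (Real.cosh_pos (a * x)).ne'
  have hy := (Real.cosh_pos (a * y)).ne'
  have e : Real.tanh (a * x) - Real.tanh (a * y) =
      Real.sinh (a * x - a * y) / (Real.cosh (a * x) * Real.cosh (a * y)) := by
    rw [Real.sinh_sub, Real.tanh_eq_sinh_div_cosh, Real.tanh_eq_sinh_div_cosh]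
    field_simp
  have e2 : a / Real.cosh (a * x) ^ 2 * (a / Real.cosh (a * y) ^ 2) *
      ((x - y) / (Real.tanh (a * x) - Real.tanh (a * y))) ^ 2
      = (a * x - a * y) ^ 2 / Real.sinh (a * x - a * y) ^ 2 := by
    rw [e, ← mul_sub]
    field_simp
  simp only
  rw [e2]
  exact div_le_one_of_le₀ (aux_sq_le_sinh_sq _) (sq_nonneg _)

lemma aux_deriv_sum (x : ℝ) :
    deriv (fun t : ℝ => Real.tanh (4 * t) + Real.tanh (t / 4)) x =
      4 / Real.cosh (4 * x) ^ 2 + 4⁻¹ / Real.cosh (4⁻¹ * x) ^ 2 := by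
  have h := (aux_deriv_scaled 4 x).add (aux_deriv_scaled 4⁻¹ x)
  rw [← h.deriv]
  congr 1
  funext t
  simp [div_eq_inv_mul]

lemma aux_witness :
    deriv (fun t : ℝ => Real.tanh (4 * t) + Real.tanh (t / 4)) 4 *
      deriv (fun t : ℝ => Real.tanh (4 * t) + Real.tanh (t / 4)) 0 *
      ((4 - 0) /
        ((Real.tanh (4 * 4) + Real.tanh (4 / 4)) -
          (Real.tanh (4 * 0) + Real.tanh (0 / 4)))) ^ 2 > 1 := by
  rw [aux_deriv_sum, aux_deriv_sum]
  have hc : Real.cosh 1 < 2 := by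
    rw [Real.cosh_eq]
    have h1 := Real.exp_one_lt_d9
    have h2 : Real.exp (-1) < 1 := by
      rw [Real.exp_lt_one_iff]; norm_num
    linarith
  have hc0 := Real.cosh_pos 1
  have hd : (1 / 16 : ℝ) ≤ 4⁻¹ / Real.cosh 1 ^ 2 := by
    rw [div_le_div_iff₀ (by norm_num) (by positivity)]
    nlinarith
  have hp : 0 < 4 / Real.cosh 16 ^ 2 := by
    have := Real.cosh_pos 16
    positivity
  have t1 := Real.tanh_lt_one 16
  have t2 := Real.tanh_lt_one 1
  have pos : ∀ u : ℝ, 0 < u → 0 < Real.tanh u := fun u hu => by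
    rw [Real.tanh_eq_sinh_div_cosh]
    exact div_pos (Real.sinh_pos_iff.2 hu) (Real.cosh_pos u)
  have p1 := pos 16 (by norm_num)
  have p2 := pos 1 (by norm_num)
  norm_num
  norm_num at hd
  set T := Real.tanh 16 + Real.tanh 1 with hT
  have hq : 4 < (4 / T) ^ 2 := by
    have : 2 < 4 / T := by
      rw [lt_div_iff₀ (by linarith)]
      linarith
    nlinarith
  set D := 4 / Real.cosh 16 ^ 2 + 1 / 4 / Real.cosh 1 ^ 2 with hD
  have hD' : 1 / 16 < D := by linarith
  nlinarith

theorem tanh_sum_not_nowhereCoexpanding :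
    (∀ x : ℝ, 0 < deriv (fun t : ℝ => Real.tanh (4 * t) + Real.tanh (t / 4)) x) ∧
    (∃ x y : ℝ, x ≠ y ∧
        deriv (fun t : ℝ => Real.tanh (4 * t) + Real.tanh (t / 4)) x *
          deriv (fun t : ℝ => Real.tanh (4 * t) + Real.tanh (t / 4)) y *
          ((x - y) /
            ((Real.tanh (4 * x) + Real.tanh (x / 4)) -
              (Real.tanh (4 * y) + Real.tanh (y / 4)))) ^ 2 > 1) ∧
    ¬ NowhereCoexpanding (fun t : ℝ => Real.tanh (4 * t) + Real.tanh (t / 4)) ∧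
    NowhereCoexpanding (fun t : ℝ => Real.tanh (4 * t)) ∧
    NowhereCoexpanding (fun t : ℝ => Real.tanh (t / 4)) := by
  have hpos : ∀ x : ℝ, 0 < deriv (fun t : ℝ => Real.tanh (4 * t) + Real.tanh (t / 4)) x := by
    intro x
    rw [aux_deriv_sum]
    have := Real.cosh_pos (4 * x)
    have := Real.cosh_pos (4⁻¹ * x)
    positivity
  refine ⟨hpos, ⟨4, 0, by norm_num, aux_witness⟩, ?_, aux_nowhere 4, ?_⟩
  · intro h
    have huniv : {z : ℝ | deriv (fun t : ℝ => Real.tanh (4 * t) + Real.tanh (t / 4)) z ≠ 0}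
        = Set.univ := Set.eq_univ_of_forall fun z => (hpos z).ne'
    have := h 4 0 (by norm_num) (by
      rw [huniv, connectedComponentIn_univ, PreconnectedSpace.connectedComponent_eq_univ]
      trivial)
    exact absurd aux_witness (not_lt.2 this)
  · have h := aux_nowhere 4⁻¹
    have e : (fun t : ℝ => Real.tanh (t / 4)) = fun t : ℝ => Real.tanh (4⁻¹ * t) := by
      funext t
      rw [div_eq_inv_mul]
    rw [e]
    exact h
end
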